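/- arXiv:1403.1352 — 4 statements merged into one kernel-verified Lean document; each statement's English description precedes it below -/
import Mathlib

section
/- For every integer n ≥ 2 and every real C > 0 there exists a constant c > 0 (depending only on n and C) such that the following holds for every positive integer N: if L is a finite set of lines in ℝ^n whose direction set is (C/N)-dense in the unit sphere S^{n-1}, and P ⊆ ℝ^n is a finite set such that every line l ∈ L contains at least N points of P, then |P| ≥ c·N^n. -/
/-- A line in `ℝ^n` through `x` with (unit) direction `v`. -/
def IsLineWithDir {n : ℕ} (l : Set (EuclideanSpace ℝ (Fin n)))
    (v : EuclideanSpace ℝ (Fin n)) : Prop :=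
  ‖v‖ = 1 ∧ ∃ x : EuclideanSpace ℝ (Fin n), l = {y | ∃ t : ℝ, y = x + t • v}

/-- A line in `ℝ^n`: a set of the form `{x + t • v : t ∈ ℝ}` with `v` a unit vector. -/
def IsLine {n : ℕ} (l : Set (EuclideanSpace ℝ (Fin n))) : Prop :=
  ∃ v, IsLineWithDir l v

/-- The direction set of a family of lines: all unit vectors that are directions
of some member. -/
def dirSet {n : ℕ} (L : Set (Set (EuclideanSpace ℝ (Fin n)))) :
    Set (EuclideanSpace ℝ (Fin n)) :=
  {v | ∃ l ∈ L, IsLineWithDir l v}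

/-- A subset `D` of the unit sphere is `δ`-dense if every unit vector lies within
Euclidean distance `δ` of some point of `D`. -/
def IsDenseInSphere {n : ℕ} (D : Set (EuclideanSpace ℝ (Fin n))) (δ : ℝ) : Prop :=
  ∀ u : EuclideanSpace ℝ (Fin n), ‖u‖ = 1 → ∃ v ∈ D, dist u v ≤ δ
open MvPolynomial in
theorem MvPolynomial.aeval_mul_left_of_isHomogeneous {σ R A : Type*} [Fintype σ] [CommSemiring R]
    [CommSemiring A] [Algebra R A] {f : MvPolynomial σ R} {d : ℕ} (hf : f.IsHomogeneous d)
    (c : A) (a : σ → A) : aeval (fun i => c * a i) f = c ^ d * aeval a f := by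
  rw [aeval_def, aeval_def, eval₂_eq', eval₂_eq', Finset.mul_sum]
  refine Finset.sum_congr rfl fun s hs => ?_
  have h : ∑ i, s i = d := by
    rw [← Finsupp.degree_eq_sum]
    exact not_imp_comm.1 (hf.coeff_eq_zero (d := s)) (mem_support_iff.1 hs)
  simp only [mul_pow, Finset.prod_mul_distrib, Finset.prod_pow_eq_pow_sum, h]
  ring

open MvPolynomial in
/-- The top-degree homogeneous part of a polynomial vanishes at the direction of any line on which
the polynomial has more zeros than its degree. -/
theorem MvPolynomial.aeval_homogeneousComponent_totalDegree_eq_zero {σ : Type*} [Fintype σ]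
    {p : MvPolynomial σ ℝ} {x v : σ → ℝ} {T : Finset ℝ} (hT : p.totalDegree < T.card)
    (h : ∀ t ∈ T, aeval (fun i => x i + t * v i) p = 0) :
    aeval v (homogeneousComponent p.totalDegree p) = 0 := by
  set d := p.totalDegree with hd
  have hline : ∀ t : ℝ, aeval (fun i => x i + t * v i) p = 0 := by
    set q : Polynomial ℝ :=
      aeval (fun i => Polynomial.C (x i) + Polynomial.X * Polynomial.C (v i)) p with hq
    have heval : ∀ t : ℝ, q.eval t = aeval (fun i => x i + t * v i) p := by
      intro t
      rw [hq, ← Polynomial.coe_aeval_eq_eval, ← AlgHom.comp_apply, comp_aeval]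
      simp [fun i => mul_comm (v i) t]
    have hdeg : q.natDegree ≤ d * 1 := by
      refine aeval_natDegree_le p le_rfl _ fun i => ?_
      compute_degree
    have : q = 0 := Polynomial.eq_zero_of_natDegree_lt_card_of_eval_eq_zero' q T
      (fun t ht => by rw [heval, h t ht]) (by omega)
    intro t
    rw [← heval, this, Polynomial.eval_zero]
  set F : ℝ → ℝ := fun s =>
    ∑ j ∈ Finset.range (d + 1), s ^ (d - j) *
      aeval (fun i => s * x i + v i) (homogeneousComponent j p) with hF
  have hcont : Continuous F := by
    simp only [hF, aeval_def, eval₂_eq']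
    fun_prop
  have hzero : ∀ s ≠ 0, F s = 0 := by
    intro s hs
    have h1 : F s = s ^ d * aeval (fun i => x i + s⁻¹ * v i) p := by
      conv_rhs => rw [← sum_homogeneousComponent p]
      rw [map_sum, Finset.mul_sum]
      refine Finset.sum_congr rfl fun j hj => ?_
      have hj : j ≤ d := by simpa [Nat.lt_succ_iff] using hj
      have h2 : (fun i => s * x i + v i) = fun i => s * (x i + s⁻¹ * v i) := by
        ext i; field_simp
      rw [h2, aeval_mul_left_of_isHomogeneous (homogeneousComponent_isHomogeneous j p), ← mul_assoc, ← pow_add,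
        Nat.sub_add_cancel hj]
    rw [h1, hline, mul_zero]
  have h0 : F 0 = 0 := by
    have := hcont.ext_on (dense_compl_singleton (0 : ℝ)) continuous_const
      (g := fun _ => (0 : ℝ)) (fun s hs => hzero s hs)
    rw [this]
  have h1 : F 0 = aeval v (homogeneousComponent d p) := by
    simp only [hF]
    rw [Finset.sum_eq_single d]
    · simp
    · intro j hj hjd
      rw [Finset.mem_range] at hj
      rw [zero_pow (by omega), zero_mul]
    · simp
  rw [← h1, h0]

open MvPolynomial in
/-- Fewer than `(k + 1) ^ n` points are contained in the zero set of a nonzero polynomial of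
degree at most `k` in each variable. -/
theorem MvPolynomial.exists_ne_zero_forall_mem_aeval_eq_zero {σ : Type*} [Fintype σ] (k : ℕ)
    (S : Finset (σ → ℝ)) (hS : S.card < (k + 1) ^ Fintype.card σ) :
    ∃ p : MvPolynomial σ ℝ, p ≠ 0 ∧ p.totalDegree ≤ Fintype.card σ * k ∧
      ∀ x ∈ S, aeval x p = 0 := by
  classical
  let e : (σ → Fin (k + 1)) → (σ →₀ ℕ) := fun m => Finsupp.equivFunOnFinite.symm fun i => m i
  have he : Function.Injective e := by
    intro a b hab
    ext i
    exact DFunLike.congr_fun hab i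
  let P : ((σ → Fin (k + 1)) → ℝ) →ₗ[ℝ] MvPolynomial σ ℝ :=
    Fintype.linearCombination ℝ fun m => monomial (e m) (1 : ℝ)
  have hP : ∀ a, P a = ∑ m, monomial (e m) (a m) := by
    intro a
    simp [P, Fintype.linearCombination_apply, smul_monomial]
  let Φ : ((σ → Fin (k + 1)) → ℝ) →ₗ[ℝ] (S → ℝ) :=
    LinearMap.pi fun x => (aeval x.1).toLinearMap ∘ₗ P
  have hker : LinearMap.ker Φ ≠ ⊥ := by
    refine LinearMap.ker_ne_bot_of_finrank_lt ?_
    simpa using hS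
  obtain ⟨a, ha, ha0⟩ := (Submodule.ne_bot_iff _).1 hker
  refine ⟨P a, ?_, ?_, ?_⟩
  · intro h
    apply ha0
    ext m
    have : coeff (e m) (P a) = a m := by
      rw [hP, coeff_sum]
      simp [coeff_monomial, he.eq_iff]
    rw [← this, h, coeff_zero, Pi.zero_apply]
  · rw [hP]
    refine totalDegree_finsetSum_le fun m _ => (totalDegree_monomial_le _ _).trans ?_
    rw [Finsupp.sum_fintype _ _ (fun _ => rfl), ← smul_eq_mul, ← Finset.card_univ]
    exact Finset.sum_le_card_nsmul _ _ _ fun i _ => Nat.lt_succ_iff.1 (m i).2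
  · intro x hx
    exact congr_fun (LinearMap.mem_ker.1 ha) ⟨x, hx⟩

/-- A Bernstein-type inequality: if `F` and its reversal `z ^ m * F z⁻¹` are entire and bounded by
`M` on the unit circle, then `F` is Lipschitz on the closed unit disc with constant `O(m M)`. -/
theorem norm_sub_le_of_norm_le_on_unit_circle {F G : ℂ → ℂ} (hF : Differentiable ℂ F)
    (hG : Differentiable ℂ G) {m : ℕ} (hFG : ∀ z ≠ 0, F z = z ^ m * G z⁻¹) {M R : ℝ}
    (hFM : ∀ z : ℂ, ‖z‖ = 1 → ‖F z‖ ≤ M) (hGM : ∀ z : ℂ, ‖z‖ = 1 → ‖G z‖ ≤ M)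
    (hR : 0 < R) (hmR : m * R ≤ 1) {z w : ℂ} (hz : ‖z‖ ≤ 1) (hw : ‖w‖ ≤ 1) :
    ‖F z - F w‖ ≤ 3 * M / R * ‖z - w‖ := by
  have hM : 0 ≤ M := (norm_nonneg _).trans (hFM 1 (by simp))
  have disc : ∀ H : ℂ → ℂ, Differentiable ℂ H → (∀ z : ℂ, ‖z‖ = 1 → ‖H z‖ ≤ M) →
      ∀ z : ℂ, ‖z‖ ≤ 1 → ‖H z‖ ≤ M := by
    intro H hH hHM z hz
    refine Complex.norm_le_of_forall_mem_frontier_norm_le (U := Metric.ball 0 1)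
      Metric.isBounded_ball hH.diffContOnCl ?_ ?_
    · intro y hy
      rw [frontier_ball _ one_ne_zero] at hy
      exact hHM y (by simpa using hy)
    · rw [closure_ball _ one_ne_zero]
      simpa using hz
  have growth : ∀ z : ℂ, ‖z‖ ≤ 1 + R → ‖F z‖ ≤ 3 * M := by
    intro z hz
    rcases le_or_gt ‖z‖ 1 with h | h
    · linarith [disc F hF hFM z h]
    · have hz0 : z ≠ 0 := by
        rintro rfl
        norm_num at h
      have h1 : ‖G z⁻¹‖ ≤ M := disc G hG hGM _ (by
        rw [norm_inv]
        exact inv_le_one_of_one_le₀ h.le)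
      have h2 : ‖z‖ ^ m ≤ 3 := calc
        ‖z‖ ^ m ≤ (Real.exp R) ^ m := by
          gcongr
          linarith [Real.add_one_le_exp R]
        _ = Real.exp (m * R) := (Real.exp_nat_mul R m).symm
        _ ≤ Real.exp 1 := Real.exp_le_exp.2 hmR
        _ ≤ 3 := by linarith [Real.exp_one_lt_d9]
      rw [hFG z hz0, norm_mul, norm_pow]
      exact mul_le_mul h2 h1 (norm_nonneg _) (by norm_num)
  refine (convex_closedBall (0 : ℂ) 1).norm_image_sub_le_of_norm_deriv_le
    (fun x _ => hF x) (fun c hc => ?_) (by simpa using hw) (by simpa using hz)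
  refine Complex.norm_deriv_le_of_forall_mem_sphere_norm_le hR hF.diffContOnCl fun y hy => ?_
  apply growth
  have h1 : ‖y - c‖ = R := by simpa [dist_eq_norm] using hy
  have h2 : ‖c‖ ≤ 1 := by simpa using hc
  calc ‖y‖ = ‖c + (y - c)‖ := by ring_nf
    _ ≤ ‖c‖ + ‖y - c‖ := norm_add_le _ _
    _ ≤ 1 + R := by linarith

open MvPolynomial in
theorem MvPolynomial.abs_aeval_le_mul_dist_of_isHomogeneous {n d : ℕ} {f : MvPolynomial (Fin n) ℝ}
    (hf : f.IsHomogeneous d) {M : ℝ}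
    (hM : ∀ x : EuclideanSpace ℝ (Fin n), ‖x‖ = 1 → |aeval x.ofLp f| ≤ M)
    {R : ℝ} (hR : 0 < R) (hdR : 2 * d * R ≤ 1) {u v : EuclideanSpace ℝ (Fin n)}
    (hu : ‖u‖ = 1) (hv : ‖v‖ = 1) (hfu : aeval u.ofLp f ≠ 0) (hfv : aeval v.ofLp f = 0) :
    |aeval u.ofLp f| ≤ 3 * M / R * dist u v := by
  set c : ℝ := inner ℝ u v with hc
  have hsmul : ∀ (b : ℝ) (x : EuclideanSpace ℝ (Fin n)),
      aeval (b • x).ofLp f = b ^ d * aeval x.ofLp f := fun b x => aeval_mul_left_of_isHomogeneous hf b x.ofLp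
  set y := v - c • u with hy
  have huy : inner ℝ u y = 0 := by
    rw [hy, inner_sub_right, inner_smul_right, real_inner_self_eq_norm_sq, hu]
    simp [hc]
  have hvy : v = c • u + y := by rw [hy]; abel
  have hpyth : ∀ (a b : ℝ) (w : EuclideanSpace ℝ (Fin n)), inner ℝ u w = 0 →
      ‖a • u + b • w‖ ^ 2 = a ^ 2 + b ^ 2 * ‖w‖ ^ 2 := by
    intro a b w h
    rw [norm_add_sq_real, norm_smul, norm_smul, inner_smul_left, inner_smul_right, h, hu]
    simp [mul_pow]
  have hs0 : ‖y‖ ≠ 0 := by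
    intro h
    rw [norm_eq_zero] at h
    rw [h, add_zero] at hvy
    have hc0 : c ≠ 0 := by
      intro hc0
      rw [hvy, hc0] at hv
      simp at hv
    rw [hvy, hsmul] at hfv
    exact mul_ne_zero (pow_ne_zero _ hc0) hfu hfv
  set s : ℝ := ‖y‖ with hs
  set w := s⁻¹ • y with hw
  have huw : inner ℝ u w = 0 := by rw [hw, inner_smul_right, huy, mul_zero]
  have hw1 : ‖w‖ = 1 := by rw [hw, norm_smul, norm_inv, norm_norm, inv_mul_cancel₀ hs0]
  have hvw : v = c • u + s • w := by
    rw [hw, smul_smul, mul_inv_cancel₀ hs0, one_smul, ← hvy]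
  have hcs : c ^ 2 + s ^ 2 = 1 := by
    have := hpyth c s w huw
    rw [← hvw, hv, hw1] at this
    linarith
  -- the restriction of `f` to the great circle through `u` and `w`, in the variable `exp (i θ)`
  let F : ℂ → ℂ → ℂ := fun ε z =>
    aeval (fun i => (z ^ 2 + 1) / 2 * (u i : ℂ) + ε * ((z ^ 2 - 1) / (2 * Complex.I)) * (w i : ℂ)) f
  have hdiff : ∀ ε, Differentiable ℂ (F ε) := by
    intro ε
    simp only [F, aeval_def, eval₂_eq']
    fun_prop
  have hcirc : ∀ (ε a b : ℝ), a ^ 2 + b ^ 2 = 1 → F ε (a + b * Complex.I) =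
      (a + b * Complex.I) ^ d * ((aeval (a • u + (ε * b) • w).ofLp f : ℝ) : ℂ) := by
    intro ε a b hab
    have hab' : (a : ℂ) ^ 2 + (b : ℂ) ^ 2 = 1 := by exact_mod_cast hab
    have h1 : ((aeval (a • u + (ε * b) • w).ofLp f : ℝ) : ℂ) =
        aeval (fun i => (((a • u + (ε * b) • w) i : ℝ) : ℂ)) f :=
      (aeval_algebraMap_apply ℂ (a • u + (ε * b) • w).ofLp f).symm
    rw [h1, ← aeval_mul_left_of_isHomogeneous hf]
    simp only [F]
    congr 2
    ext i
    have hI : Complex.I ^ 2 = -1 := Complex.I_sq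
    have h2 : ((a + b * Complex.I) ^ 2 + 1) / 2 = (a + b * Complex.I) * (a : ℂ) := by
      linear_combination (b ^ 2 / 2 : ℂ) * hI - hab' / 2
    have h3 : ((a + b * Complex.I) ^ 2 - 1) / (2 * Complex.I) = (a + b * Complex.I) * (b : ℂ) := by
      rw [div_eq_iff (by simp)]
      linear_combination hab' - (b ^ 2 : ℂ) * hI
    rw [h2, h3]
    simp
    ring
  have hbound : ∀ ε : ℝ, ε ^ 2 = 1 → ∀ z : ℂ, ‖z‖ = 1 → ‖F ε z‖ ≤ M := by
    intro ε hε z hz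
    have hab : z.re ^ 2 + z.im ^ 2 = 1 := by
      have := Complex.sq_norm z
      rw [hz, Complex.normSq_apply] at this
      linarith
    have := hcirc ε z.re z.im hab
    rw [Complex.re_add_im] at this
    rw [this, norm_mul, norm_pow, hz, one_pow, one_mul, Complex.norm_real]
    apply hM
    have h := hpyth z.re (ε * z.im) w huw
    rw [hw1, mul_pow, hε] at h
    rw [← sq_eq_sq₀ (norm_nonneg _) zero_le_one, h]
    linarith
  have hrev : ∀ z ≠ 0, F 1 z = z ^ (2 * d) * F (-1) z⁻¹ := by
    intro z hz
    simp only [F]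
    rw [pow_mul, ← aeval_mul_left_of_isHomogeneous hf]
    congr 2
    ext i
    field_simp
    ring
  have hz1 : ‖(c + s * Complex.I : ℂ)‖ = 1 := by
    rw [← sq_eq_sq₀ (norm_nonneg _) zero_le_one, Complex.sq_norm, Complex.normSq_add_mul_I, hcs,
      one_pow]
  have key := norm_sub_le_of_norm_le_on_unit_circle (hdiff 1) (hdiff (-1)) hrev
    (by simpa using hbound 1 (by norm_num)) (by simpa using hbound (-1) (by norm_num)) hR
    (by push_cast; exact hdR) (z := 1) (w := c + s * Complex.I) (by simp) hz1.le
  have e1 : F 1 1 = ((aeval u.ofLp f : ℝ) : ℂ) := by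
    simpa using hcirc 1 1 0 (by norm_num)
  have e2 : F 1 (c + s * Complex.I) = 0 := by
    have := hcirc 1 c s hcs
    rw [one_mul, ← hvw, hfv] at this
    simpa using this
  have e3 : ‖(1 : ℂ) - (c + s * Complex.I)‖ = dist u v := by
    rw [← sq_eq_sq₀ (norm_nonneg _) dist_nonneg, dist_eq_norm, norm_sub_sq_real u v, hu, hv, ← hc,
      Complex.sq_norm, Complex.normSq_apply]
    simp
    linarith
  rwa [e1, e2, sub_zero, e3, Complex.norm_real] at key

open MvPolynomial in
/-- A nonzero homogeneous polynomial of degree `d` cannot vanish on a `δ`-dense subset of the sphere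
when `δ` is much smaller than `1 / d`. -/
theorem MvPolynomial.le_of_isDenseInSphere_of_isHomogeneous {n d : ℕ} [NeZero n]
    {f : MvPolynomial (Fin n) ℝ} (hf : f.IsHomogeneous d) (hf0 : f ≠ 0)
    {D : Set (EuclideanSpace ℝ (Fin n))} {δ : ℝ} (hD : IsDenseInSphere D δ)
    (hD1 : ∀ v ∈ D, ‖v‖ = 1) (hfD : ∀ v ∈ D, aeval v.ofLp f = 0) {R : ℝ} (hR : 0 < R)
    (hdR : 2 * d * R ≤ 1) : R ≤ 3 * δ := by
  obtain ⟨x, hx, hfx⟩ : ∃ x : EuclideanSpace ℝ (Fin n), x ≠ 0 ∧ aeval x.ofLp f ≠ 0 := by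
    have h : f * X 0 ≠ 0 := mul_ne_zero hf0 (X_ne_zero 0)
    by_contra! hcon
    apply h
    refine MvPolynomial.funext fun x => ?_
    rw [map_mul, eval_X, map_zero]
    by_cases hx : WithLp.toLp 2 x = 0
    · have : x 0 = 0 := congr_arg (fun y : EuclideanSpace ℝ (Fin n) => y 0) hx
      rw [this, mul_zero]
    · have := hcon _ hx
      rw [← coe_aeval_eq_eval]
      simp only [RingHom.coe_coe]
      rw [this, zero_mul]
  have hcont : Continuous fun y : EuclideanSpace ℝ (Fin n) => |aeval y.ofLp f| := by
    simp only [aeval_def, eval₂_eq']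
    fun_prop
  have hx0 : ‖x‖ ≠ 0 := norm_ne_zero_iff.2 hx
  have hx1 : ‖(‖x‖⁻¹ • x)‖ = 1 := by rw [norm_smul, norm_inv, norm_norm, inv_mul_cancel₀ hx0]
  obtain ⟨u, hu, hmax⟩ := (isCompact_sphere (0 : EuclideanSpace ℝ (Fin n)) 1).exists_isMaxOn
    ⟨‖x‖⁻¹ • x, by simpa using hx1⟩ hcont.continuousOn
  have hu1 : ‖u‖ = 1 := by simpa using hu
  have hM : ∀ y : EuclideanSpace ℝ (Fin n), ‖y‖ = 1 → |aeval y.ofLp f| ≤ |aeval u.ofLp f| :=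
    fun y hy => hmax (by simpa using hy)
  have hpos : 0 < |aeval u.ofLp f| := by
    refine lt_of_lt_of_le ?_ (hM _ hx1)
    have : aeval (‖x‖⁻¹ • x).ofLp f = ‖x‖⁻¹ ^ d * aeval x.ofLp f := aeval_mul_left_of_isHomogeneous hf _ x.ofLp
    rw [this]
    exact abs_pos.2 (mul_ne_zero (pow_ne_zero _ (inv_ne_zero hx0)) hfx)
  obtain ⟨v, hv, huv⟩ := hD u hu1
  have key := abs_aeval_le_mul_dist_of_isHomogeneous hf hM hR hdR hu1 (hD1 v hv) (abs_pos.1 hpos) (hfD v hv)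
  rw [div_mul_eq_mul_div, le_div_iff₀ hR] at key
  have : R ≤ 3 * dist u v := le_of_mul_le_mul_left (by linarith) hpos
  linarith

/-- Discrete model of the Kakeya conjecture in `ℝ^n`, case (a) (dense directions):
if the direction set of a finite family `L` of lines is `(C/N)`-dense in `S^{n-1}`
and each line of `L` contains at least `N` points of a finite set `P`, then
`|P| ≥ c · N^n`. -/
theorem discrete_kakeya_dense
    (n : ℕ) (hn : 2 ≤ n) (C : ℝ) (hC : 0 < C) :
    ∃ c : ℝ, 0 < c ∧
      ∀ N : ℕ, 0 < N →
        ∀ L : Set (Set (EuclideanSpace ℝ (Fin n))), L.Finite →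
          (∀ l ∈ L, IsLine l) →
          IsDenseInSphere (dirSet L) (C / N) →
          ∀ P : Set (EuclideanSpace ℝ (Fin n)), P.Finite →
            (∀ l ∈ L, N ≤ (P ∩ l).ncard) →
            c * (N : ℝ) ^ n ≤ (P.ncard : ℝ) := by
  have hn0 : (0 : ℝ) < n := by positivity
  have : NeZero n := ⟨by omega⟩
  set A : ℝ := 8 * n * (C + 1) with hA
  have hA0 : 0 < A := by positivity
  refine ⟨(A⁻¹) ^ n, by positivity, ?_⟩
  intro N hN L _ _ hdense P hP hPL
  have hN0 : (0 : ℝ) < N := by exact_mod_cast hN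
  set k := ⌊(N : ℝ) / A⌋₊ with hk
  have hkle : (k : ℝ) * A ≤ N := (le_div_iff₀ hA0).1 (Nat.floor_le (by positivity))
  have hklt : (N : ℝ) / A < k + 1 := Nat.lt_floor_add_one _
  suffices h : (k + 1) ^ n ≤ P.ncard by
    calc A⁻¹ ^ n * (N : ℝ) ^ n = (N / A) ^ n := by rw [← mul_pow, inv_mul_eq_div]
      _ ≤ ((k : ℝ) + 1) ^ n := by gcongr
      _ ≤ P.ncard := by exact_mod_cast h
  by_contra! hlt
  classical
  obtain ⟨p, hp0, hpd, hpv⟩ := MvPolynomial.exists_ne_zero_forall_mem_aeval_eq_zero k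
    (hP.toFinset.image fun x => x.ofLp) (by
      refine Finset.card_image_le.trans_lt ?_
      rwa [← Set.ncard_eq_toFinset_card P hP, Fintype.card_fin])
  rw [Fintype.card_fin] at hpd
  have hdA : (p.totalDegree : ℝ) * (8 * (C + 1)) ≤ N := calc
    (p.totalDegree : ℝ) * (8 * (C + 1)) ≤ (n * k : ℕ) * (8 * (C + 1)) := by gcongr
    _ = k * A := by push_cast; ring
    _ ≤ N := hkle
  have hdN : p.totalDegree < N := by
    have : (p.totalDegree : ℝ) < N := by
      nlinarith [(Nat.cast_nonneg p.totalDegree : (0 : ℝ) ≤ p.totalDegree)]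
    exact_mod_cast this
  have htop : MvPolynomial.homogeneousComponent p.totalDegree p ≠ 0 := by
    intro h
    obtain ⟨s, hs, hsd⟩ := Finset.exists_mem_eq_sup p.support
      (MvPolynomial.support_nonempty.2 hp0) fun s => s.sum fun _ e => e
    have hc := MvPolynomial.coeff_homogeneousComponent p.totalDegree p s
    rw [h, MvPolynomial.coeff_zero, if_pos] at hc
    · exact MvPolynomial.mem_support_iff.1 hs hc.symm
    · exact hsd.symm
  have hvan : ∀ v ∈ dirSet L,
      MvPolynomial.aeval v.ofLp (MvPolynomial.homogeneousComponent p.totalDegree p) = 0 := by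
    rintro v ⟨l, hl, hv1, x, rfl⟩
    have hfin : {t : ℝ | x + t • v ∈ P}.Finite := by
      refine hP.preimage (Function.Injective.injOn fun a b hab => ?_)
      have hv0 : v ≠ 0 := by
        rintro rfl
        simp at hv1
      exact smul_left_injective ℝ hv0 (add_left_cancel hab)
    refine MvPolynomial.aeval_homogeneousComponent_totalDegree_eq_zero (x := x.ofLp)
      (T := hfin.toFinset) ?_ ?_
    · refine hdN.trans_le ((hPL _ hl).trans ?_)
      rw [← Set.ncard_eq_toFinset_card _ hfin]
      refine le_trans (Set.ncard_le_ncard ?_ (hfin.image fun t => x + t • v))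
        (Set.ncard_image_le hfin)
      rintro y ⟨hy, t, rfl⟩
      exact ⟨t, hy, rfl⟩
    · intro t ht
      have ht : x + t • v ∈ P := by simpa using ht
      exact hpv _ (Finset.mem_image.2 ⟨x + t • v, by simpa using ht, rfl⟩)
  have key := MvPolynomial.le_of_isDenseInSphere_of_isHomogeneous
    (MvPolynomial.homogeneousComponent_isHomogeneous p.totalDegree p)
    htop hdense (by rintro v ⟨l, _, hv, _⟩; exact hv) hvan (R := 4 * (C + 1) / N) (by positivity)
    (by
      rw [mul_div_assoc', div_le_one hN0]
      linarith)
  rw [mul_div_assoc', div_le_div_iff_of_pos_right hN0] at key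
  linarith
end

section
/- For every integer n ≥ 2 and every real C > 0 there exists a constant K > 0 (depending only on n and C) such that for every real β with 0 ≤ β ≤ 1 and every sufficiently large positive integer N, there exist a finite set L of lines in ℝ^n and a finite set P ⊆ ℝ^n with the following properties: the direction set of L is (C/N)-dense in the unit sphere S^{n-1}; every line l ∈ L contains at least N^β points of P; and |P| ≤ K·N^{(n-1)/2 + (n+1)β/2}. In particular, the exponent (n-1)/2 + (n+1)β/2 in the discrete Furstenberg lower bound cannot be improved. -/
/-- The point of `ℝ^n` with integer coordinates `k`. -/
noncomputable def latticePoint {n : ℕ} (k : Fin n → ℤ) : EuclideanSpace ℝ (Fin n) :=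
  WithLp.toLp 2 fun j => (k j : ℝ)

@[simp]
theorem latticePoint_apply {n : ℕ} (k : Fin n → ℤ) (j : Fin n) : latticePoint k j = (k j : ℝ) :=
  rfl

/-- The image of the lattice point `(t, y)` under the projective map sending the hyperplane
`{t = -1 / B}` to infinity, rescaled by `M`. -/
noncomputable def projectedPoint {n : ℕ} (M B t : ℕ) (y : Fin n → ℤ) : EuclideanSpace ℝ (Fin n) :=
  ((B : ℝ) / (M * (B * t + 1))) • latticePoint y

/-- The line in direction `k` which is the projective image of a line through lattice points. -/
def projectedLine {n : ℕ} (M B : ℕ) (k : Fin n → ℤ) : Set (EuclideanSpace ℝ (Fin n)) :=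
  {y | ∃ t : ℝ, y = (M : ℝ)⁻¹ • latticePoint (fun j => (-k j) % (B : ℤ)) + t • latticePoint k}

theorem isLineWithDir_normalize {n : ℕ} (x z : EuclideanSpace ℝ (Fin n)) {μ : ℝ} (hμ : μ ≠ 0)
    (hz : z ≠ 0) :
    IsLineWithDir {y | ∃ t : ℝ, y = x + t • z} (‖μ • z‖⁻¹ • μ • z) := by
  have hne : ‖μ • z‖ ≠ 0 := norm_ne_zero_iff.mpr (smul_ne_zero hμ hz)
  refine ⟨by rw [norm_smul, norm_inv, norm_norm, inv_mul_cancel₀ hne], x, ?_⟩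
  ext y
  constructor
  · rintro ⟨t, rfl⟩
    refine ⟨t * μ⁻¹ * ‖μ • z‖, ?_⟩
    rw [smul_smul, smul_smul]
    congr 2
    field_simp
  · rintro ⟨t, rfl⟩
    exact ⟨t * (‖μ • z‖⁻¹ * μ), by simp only [smul_smul]⟩

theorem norm_le_card_mul {n : ℕ} (x : EuclideanSpace ℝ (Fin n)) {c : ℝ}
    (h : ∀ j, |x j| ≤ c) : ‖x‖ ≤ n * c := by
  calc ‖x‖ = ‖∑ j, x j • EuclideanSpace.basisFun (Fin n) ℝ j‖ := by
        congr 1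
        simpa using ((EuclideanSpace.basisFun (Fin n) ℝ).sum_repr x).symm
    _ ≤ ∑ j, ‖x j • EuclideanSpace.basisFun (Fin n) ℝ j‖ := norm_sum_le _ _
    _ ≤ ∑ _j : Fin n, c := Finset.sum_le_sum fun j _ => by
        simpa [norm_smul] using h j
    _ = n * c := by simp

theorem exists_latticePoint_dist_le {n q : ℕ} (hq : 0 < q) (u : EuclideanSpace ℝ (Fin n))
    (hu : ‖u‖ = 1) :
    ∃ (i : Fin n) (k : Fin n → ℤ) (μ : ℝ), k i = q ∧ (∀ j, |k j| ≤ q) ∧ μ ≠ 0 ∧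
      dist u (‖μ • latticePoint k‖⁻¹ • μ • latticePoint k) ≤ 2 * n / q := by
  have hq' : (0 : ℝ) < q := by exact_mod_cast hq
  have hu0 : u ≠ 0 := by rintro rfl; simp at hu
  obtain ⟨j₀, hj₀⟩ : ∃ j, u j ≠ 0 := by
    by_contra! h
    exact hu0 (by ext j; simpa using h j)
  obtain ⟨i, -, hi⟩ := Finset.exists_max_image Finset.univ (fun j => |u j|) ⟨j₀, Finset.mem_univ _⟩
  have hi0 : u i ≠ 0 := abs_pos.mp ((abs_pos.mpr hj₀).trans_le (hi j₀ (Finset.mem_univ _)))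
  have hratio (j : Fin n) : |u j / u i| ≤ 1 := by
    rw [abs_div, div_le_one (abs_pos.mpr hi0)]
    exact hi j (Finset.mem_univ _)
  have hui : |u i| ≤ 1 := by
    simpa [hu] using PiLp.norm_apply_le u i
  set k : Fin n → ℤ := fun j => ⌊(q : ℝ) * (u j / u i)⌋ with hk
  have hki : k i = q := by simp [hk, hi0]
  have hμ : u i / q ≠ 0 := div_ne_zero hi0 hq'.ne'
  refine ⟨i, k, u i / q, hki, fun j => ?_, hμ, ?_⟩
  · obtain ⟨h1, h2⟩ := abs_le.mp (hratio j)
    refine abs_le.mpr ⟨Int.le_floor.mpr ?_, ?_⟩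
    · push_cast
      nlinarith
    · have : (k j : ℝ) ≤ (q : ℝ) := (Int.floor_le _).trans (by nlinarith)
      exact_mod_cast this
  · set z := (u i / q) • latticePoint k with hz
    have hz0 : z ≠ 0 := by
      refine smul_ne_zero hμ fun h => ?_
      have := congrArg (fun x : EuclideanSpace ℝ (Fin n) => x i) h
      simp [hki, hq.ne'] at this
    have hclose : ‖u - z‖ ≤ n / q := by
      have := norm_le_card_mul (u - z) (c := 1 / q) fun j => by
        have e : (u - z) j = u i / q * Int.fract ((q : ℝ) * (u j / u i)) := by
          simp only [hz, PiLp.sub_apply, PiLp.smul_apply, latticePoint_apply, smul_eq_mul, hk,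
            Int.fract]
          field_simp
        rw [e, abs_mul, abs_div, abs_of_pos hq',
          abs_of_nonneg (Int.fract_nonneg ((q : ℝ) * (u j / u i)))]
        calc |u i| / q * Int.fract ((q : ℝ) * (u j / u i)) ≤ 1 / q * 1 := by
              gcongr
              exact (Int.fract_lt_one _).le
          _ = 1 / q := mul_one _
      rwa [mul_one_div] at this
    have hnormalize : ‖z - ‖z‖⁻¹ • z‖ ≤ ‖u - z‖ := by
      have hzn : ‖z‖ ≠ 0 := norm_ne_zero_iff.mpr hz0
      have e : z - ‖z‖⁻¹ • z = (1 - ‖z‖⁻¹) • z := by rw [sub_smul, one_smul]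
      have e2 : ‖z - ‖z‖⁻¹ • z‖ = |‖u‖ - ‖z‖| := by
        rw [e, norm_smul, hu, Real.norm_eq_abs]
        nth_rw 2 [← abs_of_nonneg (norm_nonneg z)]
        rw [← abs_mul, sub_mul, one_mul, inv_mul_cancel₀ hzn, abs_sub_comm]
      exact e2 ▸ abs_norm_sub_norm_le u z
    calc dist u (‖z‖⁻¹ • z) ≤ dist u z + dist z (‖z‖⁻¹ • z) := dist_triangle _ _ _
      _ ≤ n / q + n / q := by
          rw [dist_eq_norm, dist_eq_norm]
          exact add_le_add hclose (hnormalize.trans hclose)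
      _ = 2 * n / q := by ring

theorem exists_furstenberg_configuration (n r B : ℕ) (hr : 0 < r) (hB : 0 < B) :
    ∃ (L : Set (Set (EuclideanSpace ℝ (Fin n)))) (P : Set (EuclideanSpace ℝ (Fin n))),
      L.Finite ∧ (∀ l ∈ L, IsLine l) ∧
      IsDenseInSphere (dirSet L) (2 * n / ((r * B * B : ℕ) : ℝ)) ∧
      P.Finite ∧ (∀ l ∈ L, r ≤ (P ∩ l).ncard) ∧
      P.ncard ≤ n * (r * (6 * (r * B) + 1) ^ (n - 1)) := by
  classical
  set M := r * B with hM
  have hM0 : 0 < M := Nat.mul_pos hr hB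
  have hBR : (0 : ℝ) < B := by exact_mod_cast hB
  have hMR : (0 : ℝ) < M := by exact_mod_cast hM0
  set q := M * B with hqdef
  have hq : 0 < q := Nat.mul_pos hM0 hB
  let box (i : Fin n) : Finset (Fin n → ℤ) :=
    Fintype.piFinset fun j => if j = i then {(M : ℤ)} else Finset.Icc (-(3 * M : ℤ)) (3 * M)
  let P : Finset (EuclideanSpace ℝ (Fin n)) :=
    Finset.univ.biUnion fun i => (Finset.Icc 1 r ×ˢ box i).image fun p => projectedPoint M B p.1 p.2
  let K : Set (Fin n → ℤ) := {k | (∃ i, k i = q) ∧ ∀ j, |k j| ≤ q}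
  have hKfin : K.Finite := by
    refine (Fintype.piFinset fun _ : Fin n => Finset.Icc (-(q : ℤ)) q).finite_toSet.subset ?_
    rintro k ⟨-, hk⟩
    exact Finset.mem_coe.mpr (Fintype.mem_piFinset.mpr fun j =>
      Finset.mem_Icc.mpr (abs_le.mp (hk j)))
  have hne {k : Fin n → ℤ} (hk : k ∈ K) : latticePoint k ≠ 0 := by
    obtain ⟨⟨i, hi⟩, -⟩ := hk
    intro h
    have := congrArg (fun x : EuclideanSpace ℝ (Fin n) => x i) h
    simp [hi, hq.ne'] at this
  refine ⟨Set.image (projectedLine M B) K, P, hKfin.image _, ?_, ?_, P.finite_toSet, ?_, ?_⟩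
  · rintro _ ⟨k, hk, rfl⟩
    exact ⟨_, isLineWithDir_normalize _ _ one_ne_zero (hne hk)⟩
  · intro u hu
    obtain ⟨i, k, μ, hki, hkq, hμ, hdist⟩ := exists_latticePoint_dist_le hq u hu
    have hk : k ∈ K := ⟨⟨i, hki⟩, hkq⟩
    exact ⟨_, ⟨_, ⟨k, hk, rfl⟩, isLineWithDir_normalize _ _ hμ (hne hk)⟩, hdist⟩
  · rintro _ ⟨k, ⟨⟨i, hki⟩, hkq⟩, rfl⟩
    set b : Fin n → ℤ := fun j => (-k j) % (B : ℤ) with hb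
    set a : Fin n → ℤ := fun j => -((-k j) / (B : ℤ)) with ha
    have hab (j : Fin n) : (B : ℤ) * a j = k j + b j := by
      have := Int.emod_add_mul_ediv (-k j) B
      simp only [ha, hb]
      linarith
    have hBZ : (0 : ℤ) < B := by exact_mod_cast hB
    have hb0 (j : Fin n) : 0 ≤ b j := Int.emod_nonneg _ hBZ.ne'
    have hbB (j : Fin n) : b j < B := Int.emod_lt_of_pos _ hBZ
    have hbi : b i = 0 := by simp [hb, hki, hqdef]
    have hai : a i = M := by
      have h := hab i
      rw [hbi, hki, hqdef] at h
      push_cast at h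
      exact mul_left_cancel₀ hBZ.ne' (by linarith)
    let y (t : ℕ) : Fin n → ℤ := fun j => a j + t * b j
    have hyi (t : ℕ) : y t i = M := by simp [y, hbi, hai]
    have hy (t : ℕ) (ht : t ∈ Finset.Icc 1 r) : y t ∈ box i := by
      refine Fintype.mem_piFinset.mpr fun j => ?_
      by_cases hj : j = i
      · subst hj
        simp [hyi]
      · simp only [hj, if_false, Finset.mem_Icc]
        obtain ⟨h1, h2⟩ := abs_le.mp (hkq j)
        have hMZ : (1 : ℤ) ≤ M := by exact_mod_cast hM0
        have hqZ : (q : ℤ) = B * M := by simp [hqdef, mul_comm]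
        have ha1 : -(M : ℤ) ≤ a j := by
          refine le_of_mul_le_mul_left ?_ hBZ
          linarith [hab j, hb0 j]
        have ha2 : a j ≤ M + 1 := by
          refine le_of_mul_le_mul_left ?_ hBZ
          linarith [hab j, hbB j]
        have htr : (t : ℤ) ≤ r := by exact_mod_cast (Finset.mem_Icc.mp ht).2
        have hMeq : (M : ℤ) = r * B := by simp [hM]
        have htb : (t : ℤ) * b j ≤ M := by
          rw [hMeq]
          exact mul_le_mul htr (hbB j).le (hb0 j) (by positivity)
        have htb0 : 0 ≤ (t : ℤ) * b j := mul_nonneg (by positivity) (hb0 j)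
        constructor <;> simp only [y] <;> linarith
    have hmaps : ∀ t ∈ Finset.Icc 1 r,
        projectedPoint M B t (y t) ∈ (P : Set _) ∩ projectedLine M B k := by
      intro t ht
      constructor
      · simp only [P, Finset.coe_biUnion, Set.mem_iUnion]
        exact ⟨i, Finset.mem_coe.mpr (Finset.mem_univ _), Finset.mem_coe.mpr
          (Finset.mem_image.mpr ⟨(t, y t), Finset.mem_product.mpr ⟨ht, hy t ht⟩, rfl⟩)⟩
      · refine ⟨1 / (M * (B * t + 1)), ?_⟩
        ext j
        have h : (B : ℝ) * a j = k j + b j := by exact_mod_cast hab j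
        have h1 : (B : ℝ) * t + 1 ≠ 0 := by positivity
        simp only [projectedPoint, PiLp.add_apply, PiLp.smul_apply, latticePoint_apply, smul_eq_mul,
          y]
        change _ = (M : ℝ)⁻¹ * (b j : ℝ) + _
        push_cast
        field_simp
        linear_combination h
    have hinj : Set.InjOn (fun t : ℕ => projectedPoint M B t (y t))
        (Finset.Icc 1 r : Finset ℕ) := by
      intro s _ t _ hst
      have h := congrArg (fun x : EuclideanSpace ℝ (Fin n) => x i) hst
      simp only [projectedPoint, PiLp.smul_apply, latticePoint_apply, smul_eq_mul, hyi,
        Int.cast_natCast] at h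
      have h1 : (B : ℝ) * t + 1 ≠ 0 := by positivity
      have h2 : (B : ℝ) * s + 1 ≠ 0 := by positivity
      field_simp at h
      have : (s : ℝ) = t := by
        refine mul_left_cancel₀ hBR.ne' ?_
        linarith
      exact_mod_cast this
    calc r = ((Finset.Icc 1 r : Finset ℕ) : Set ℕ).ncard := by
          rw [Set.ncard_coe_finset]
          simp
      _ ≤ _ := Set.ncard_le_ncard_of_injOn _ hmaps hinj (P.finite_toSet.inter_of_left _)
  · rw [Set.ncard_coe_finset]
    have hbox (i : Fin n) : (box i).card = (6 * M + 1) ^ (n - 1) := by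
      have hcard (j : Fin n) : (if j = i then {(M : ℤ)} else Finset.Icc (-(3 * M : ℤ)) (3 * M)).card
          = if j = i then 1 else 6 * M + 1 := by
        split_ifs
        · simp
        · rw [Int.card_Icc]
          omega
      simp only [box, Fintype.card_piFinset, hcard]
      rw [Finset.prod_ite, Finset.prod_const_one, one_mul, Finset.prod_const, Finset.filter_ne',
        Finset.card_erase_of_mem (Finset.mem_univ _), Finset.card_univ, Fintype.card_fin]
    calc P.card ≤ ∑ i : Fin n, ((Finset.Icc 1 r ×ˢ box i).image fun p =>
            projectedPoint M B p.1 p.2).card := Finset.card_biUnion_le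
      _ ≤ ∑ i : Fin n, r * (6 * M + 1) ^ (n - 1) := Finset.sum_le_sum fun i _ => by
          refine Finset.card_image_le.trans ?_
          rw [Finset.card_product, hbox, Nat.card_Icc, Nat.add_sub_cancel]
      _ = _ := by simp

/-- Sharpness of the discrete Furstenberg bound: for every `n ≥ 2` and `C > 0` there
is `K > 0` such that for every `β ∈ [0,1]` and all sufficiently large `N` there exist
a finite family `L` of lines whose direction set is `(C/N)`-dense in `S^{n-1}` and a
finite point set `P` with at least `N^β` points of `P` on every line of `L`, yet
`|P| ≤ K · N^{(n-1)/2 + (n+1)β/2}`. Hence the exponent cannot be improved. -/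
theorem discrete_furstenberg_sharp
    (n : ℕ) (hn : 2 ≤ n) (C : ℝ) (hC : 0 < C) :
    ∃ K : ℝ, 0 < K ∧
      ∀ β : ℝ, 0 ≤ β → β ≤ 1 →
        ∃ N₀ : ℕ, ∀ N : ℕ, N₀ ≤ N →
          ∃ (L : Set (Set (EuclideanSpace ℝ (Fin n))))
            (P : Set (EuclideanSpace ℝ (Fin n))),
            L.Finite ∧ (∀ l ∈ L, IsLine l) ∧
            IsDenseInSphere (dirSet L) (C / N) ∧
            P.Finite ∧
            (∀ l ∈ L, (N : ℝ) ^ β ≤ ((P ∩ l).ncard : ℝ)) ∧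
            (P.ncard : ℝ) ≤ K * (N : ℝ) ^ (((n : ℝ) - 1) / 2 + ((n : ℝ) + 1) * β / 2) := by
  set A : ℝ := 2 * n / C with hA
  have hn0 : (0 : ℝ) < n := by exact_mod_cast (by omega : 0 < n)
  have hA0 : 0 < A := by positivity
  set E : ℝ := 7 * ((√A + √2) * √2) with hE
  have hE0 : 0 < E := by positivity
  refine ⟨2 * n * E ^ (n - 1), by positivity, fun β hβ0 hβ1 => ⟨1, fun N hN => ?_⟩⟩
  have hN1 : (1 : ℝ) ≤ N := by exact_mod_cast hN
  have hN0 : (0 : ℝ) < N := by linarith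
  have hpow1 : (1 : ℝ) ≤ (N : ℝ) ^ β := Real.one_le_rpow hN1 hβ0
  have hpowN : (N : ℝ) ^ β ≤ N := by
    simpa using Real.rpow_le_rpow_of_exponent_le hN1 hβ1
  set r := ⌈(N : ℝ) ^ β⌉₊ with hr
  have hr0 : 0 < r := Nat.ceil_pos.mpr (by linarith)
  have hrR : (0 : ℝ) < r := by exact_mod_cast hr0
  have hrle : (r : ℝ) ≤ 2 * (N : ℝ) ^ β := by
    linarith [Nat.ceil_lt_add_one (show 0 ≤ (N : ℝ) ^ β by positivity)]
  set B := ⌈√(A * (N / r))⌉₊ with hB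
  have hB0 : 0 < B := Nat.ceil_pos.mpr (by positivity)
  have hBge : A * (N / r) ≤ (B : ℝ) ^ 2 := Real.sqrt_le_iff.mp (Nat.le_ceil _) |>.2
  have hBR : (0 : ℝ) < B := by exact_mod_cast hB0
  have hBle : (B : ℝ) ≤ (√A + √2) * √(N / r) := by
    have h1 : (1 : ℝ) ≤ √2 * √(N / r) := by
      rw [← Real.sqrt_mul (by norm_num), Real.one_le_sqrt, ← mul_div_assoc, one_le_div hrR]
      linarith
    have h2 := Nat.ceil_lt_add_one (Real.sqrt_nonneg (A * (N / r)))
    rw [← hB, Real.sqrt_mul hA0.le] at h2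
    linarith
  obtain ⟨L, P, hL, hlines, hdense, hP, hrich, hcard⟩ :=
    exists_furstenberg_configuration n r B hr0 hB0
  refine ⟨L, P, hL, hlines, fun u hu => ?_, hP, fun l hl => ?_, ?_⟩
  · obtain ⟨v, hv, huv⟩ := hdense u hu
    refine ⟨v, hv, huv.trans ?_⟩
    have hAN : A * N ≤ r * B * B := by
      have := mul_le_mul_of_nonneg_left hBge hrR.le
      calc A * N = r * (A * (N / r)) := by field_simp
        _ ≤ r * (B : ℝ) ^ 2 := this
        _ = _ := by ring
    push_cast
    rw [div_le_div_iff₀ (by positivity) hN0]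
    calc 2 * n * (N : ℝ) = C * (A * N) := by rw [hA]; field_simp
      _ ≤ C * (r * B * B) := by gcongr
  · exact (Nat.le_ceil _).trans (by exact_mod_cast hrich l hl)
  · have hrB : (r : ℝ) * B ≤ (√A + √2) * √2 * (N : ℝ) ^ ((1 + β) / 2) := by
      have h1 : (r : ℝ) * √(N / r) ≤ √2 * (N : ℝ) ^ ((1 + β) / 2) := by
        have e : (r : ℝ) * √(N / r) = √(N * r) := by
          rw [← Real.sqrt_sq hrR.le, ← Real.sqrt_mul (by positivity), Real.sqrt_sq hrR.le]
          congr 1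
          field_simp
        have e2 : (N : ℝ) ^ ((1 + β) / 2) = √((N : ℝ) * (N : ℝ) ^ β) := by
          rw [Real.sqrt_eq_rpow, ← Real.rpow_one_add' hN0.le (by linarith), ← Real.rpow_mul hN0.le]
          ring_nf
        rw [e, e2, ← Real.sqrt_mul (by norm_num)]
        refine Real.sqrt_le_sqrt ?_
        nlinarith
      calc (r : ℝ) * B ≤ r * ((√A + √2) * √(N / r)) := by gcongr
        _ = (√A + √2) * (r * √(N / r)) := by ring
        _ ≤ (√A + √2) * (√2 * (N : ℝ) ^ ((1 + β) / 2)) := by gcongr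
        _ = _ := by ring
    have hrB1 : (1 : ℝ) ≤ r * B := by exact_mod_cast Nat.mul_pos hr0 hB0
    calc (P.ncard : ℝ) ≤ n * (r * (6 * (r * B) + 1) ^ (n - 1)) := by exact_mod_cast hcard
      _ ≤ n * (2 * (N : ℝ) ^ β * (E * (N : ℝ) ^ ((1 + β) / 2)) ^ (n - 1)) := by
          gcongr
          rw [hE]
          linarith
      _ = 2 * n * E ^ (n - 1) * ((N : ℝ) ^ β * ((N : ℝ) ^ ((1 + β) / 2)) ^ (n - 1)) := by
          rw [mul_pow]
          ring
      _ = _ := by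
          rw [← Real.rpow_natCast ((N : ℝ) ^ ((1 + β) / 2)), ← Real.rpow_mul hN0.le,
            ← Real.rpow_add hN0, Nat.cast_sub (by omega)]
          congr 2
          push_cast
          ring
end

section
/- For every integer n ≥ 1 there exists a constant C_n > 0 such that for every real α with 0 < α < 1, every positive integer d, and every nonzero polynomial Q in n real variables of total degree at most d, the Lebesgue measure of the set {x ∈ [0,1]^n : dist(x, Z(Q)) ≤ α} is at most C_n·α·d, where Z(Q) = {x ∈ ℝ^n : Q(x) = 0} is the zero set of Q. -/
open MeasureTheory
namespace MvPolynomial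

theorem totalDegree_aeval_le {σ τ R : Type*} [CommSemiring R] (g : σ → MvPolynomial τ R)
    (hg : ∀ i, (g i).totalDegree ≤ 1) (p : MvPolynomial σ R) :
    (aeval g p).totalDegree ≤ p.totalDegree := by
  rw [aeval_def, eval₂_eq]
  refine totalDegree_finsetSum_le fun m hm => ?_
  refine (totalDegree_mul _ _).trans ?_
  rw [algebraMap_eq, totalDegree_C, zero_add]
  refine (totalDegree_finsetProd _ _).trans (le_trans ?_ (le_totalDegree hm))
  refine Finset.sum_le_sum fun i _ => (totalDegree_pow _ _).trans ?_
  simpa using Nat.mul_le_mul_left (m i) (hg i)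

theorem totalDegree_pderiv_le {σ R : Type*} [CommSemiring R] (i : σ) (p : MvPolynomial σ R) :
    (pderiv i p).totalDegree ≤ p.totalDegree := by
  classical
  refine Finset.sup_le fun m hm => ?_
  rw [mem_support_iff, coeff_pderiv] at hm
  have h := le_totalDegree (mem_support_iff.2 (left_ne_zero_of_mul hm))
  refine le_trans ?_ h
  change m.degree ≤ (m + Finsupp.single i 1).degree
  simp

theorem hasDerivAt_eval_update {σ : Type*} [DecidableEq σ] (p : MvPolynomial σ ℝ) (x : σ → ℝ)
    (i : σ) :
    HasDerivAt (fun t => eval (Function.update x i t) p) (eval x (pderiv i p)) (x i) := by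
  induction p using MvPolynomial.induction_on with
  | C a => simpa using hasDerivAt_const (x i) a
  | add p q hp hq => simpa using! hp.add hq
  | mul_X p j hp =>
    have hX : HasDerivAt (fun t => Function.update x i t j) (Pi.single (M := fun _ => ℝ) i 1 j)
        (x i) := by
      by_cases h : j = i
      · subst h; simpa using! hasDerivAt_id (x j)
      · simpa [h] using hasDerivAt_const (x i) (x j)
    have := hp.mul hX
    simp only [map_mul, eval_X, Function.update_eq_self] at this ⊢
    convert! this using 1
    rw [pderiv_mul, pderiv_X]
    by_cases h : j = i
    · subst h; simp
    · simp [h]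

/-- Any `k` polynomials in `k` variables, together with a further one, satisfy an algebraic relation
whose degree in the further polynomial is controlled only by the degrees of the others. -/
theorem exists_eliminant {σ : Type*} [Fintype σ] {D : ℕ} (f : σ → MvPolynomial σ ℝ)
    (hf : ∀ i, (f i).totalDegree ≤ D) (l : MvPolynomial σ ℝ) (hl : l.totalDegree ≤ 1) :
    ∃ p : MvPolynomial σ ℝ, p ≠ 0 ∧ ∀ c, eval c p ≠ 0 → ∃ q : Polynomial ℝ, q ≠ 0 ∧
      q.natDegree ≤ (Fintype.card σ * D + 1) ^ Fintype.card σ ∧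
      ∀ x, (∀ i, eval x (f i) = c i) → q.eval (eval x l) = 0 := by
  classical
  set k := Fintype.card σ
  set A := (k * D + 1) ^ k
  let T := A + k * (D * A)
  let P : Fin (A + 1) × (σ → Fin (A + 1)) → MvPolynomial σ ℝ :=
    fun ab => l ^ (ab.1 : ℕ) * ∏ i, f i ^ (ab.2 i : ℕ)
  have hP (ab) : (P ab).totalDegree ≤ T := by
    refine (totalDegree_mul _ _).trans (add_le_add ?_ ?_)
    · refine (totalDegree_pow _ _).trans ?_
      have := ab.1.is_le
      nlinarith
    · refine (totalDegree_finsetProd _ _).trans ?_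
      refine (Finset.sum_le_card_nsmul _ _ (D * A) fun i _ => ?_).trans (by simp [k])
      refine (totalDegree_pow _ _).trans ?_
      rw [mul_comm]
      exact Nat.mul_le_mul (hf i) (ab.2 i).is_le
  let L : (Fin (A + 1) × (σ → Fin (A + 1)) → ℝ) →ₗ[ℝ] ((σ → Fin (T + 1)) → ℝ) :=
    LinearMap.pi fun e => (lcoeff ℝ (Finsupp.equivFunOnFinite.symm fun i => (e i : ℕ))) ∘ₗ
      Fintype.linearCombination ℝ P
  have hL : LinearMap.ker L ≠ ⊥ := by
    apply LinearMap.ker_ne_bot_of_finrank_lt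
    simp only [Module.finrank_fintype_fun_eq_card, Fintype.card_prod, Fintype.card_fun,
      Fintype.card_fin]
    calc (T + 1) ^ k ≤ ((k * D + 1) * (A + 1)) ^ k := by
          gcongr
          simp only [T]
          nlinarith [Nat.zero_le (k * D)]
      _ = A * (A + 1) ^ k := by rw [mul_pow]
      _ < (A + 1) * (A + 1) ^ k := by gcongr; omega
  obtain ⟨w, hw, hw0⟩ := Submodule.exists_mem_ne_zero_of_ne_bot hL
  have hrel : ∑ ab, w ab • P ab = 0 := by
    have hdeg : (∑ ab, w ab • P ab).totalDegree ≤ T :=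
      totalDegree_finsetSum_le fun ab _ => (totalDegree_smul_le _ _).trans (hP ab)
    ext m
    rw [coeff_zero]
    by_cases hm : ∀ i, m i < T + 1
    · have := congrFun (LinearMap.mem_ker.1 hw) fun i => ⟨m i, hm i⟩
      simpa [L, Fintype.linearCombination_apply, lcoeff] using this
    · push Not at hm
      obtain ⟨i, hi⟩ := hm
      apply coeff_eq_zero_of_totalDegree_lt
      refine hdeg.trans_lt (lt_of_lt_of_le (Nat.lt_of_succ_le hi) ?_)
      exact Finsupp.le_degree i m
  obtain ⟨⟨a₀, b₀⟩, hab⟩ := Function.ne_iff.1 hw0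
  let p : Fin (A + 1) → MvPolynomial σ ℝ := fun a =>
    ∑ b : σ → Fin (A + 1), monomial (Finsupp.equivFunOnFinite.symm fun i => (b i : ℕ)) (w (a, b))
  have hpe (a c) : eval c (p a) = ∑ b : σ → Fin (A + 1), w (a, b) * ∏ i, c i ^ (b i : ℕ) := by
    simp [p, eval_monomial, Finsupp.prod_fintype]
  refine ⟨p a₀, fun h => hab ?_, fun c hc => ?_⟩
  · have := congrArg (coeff (Finsupp.equivFunOnFinite.symm fun i => (b₀ i : ℕ))) h
    simp only [p, coeff_sum, coeff_monomial, coeff_zero] at this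
    rw [Finset.sum_eq_single b₀] at this
    · simpa using this
    · intro b _ hb
      rw [if_neg]
      intro h
      apply hb
      funext i
      exact Fin.ext (by simpa using DFunLike.congr_fun h i)
    · simp
  · let q : Polynomial ℝ := ∑ a : Fin (A + 1), Polynomial.monomial (a : ℕ) (eval c (p a))
    refine ⟨q, fun h => hc ?_, ?_, fun x hx => ?_⟩
    · have := congrArg (fun r => Polynomial.coeff r (a₀ : ℕ)) h
      simp only [q, Polynomial.finsetSum_coeff, Polynomial.coeff_monomial,
        Polynomial.coeff_zero] at this
      rw [Finset.sum_eq_single a₀] at this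
      · simpa using this
      · intro b _ hb
        rw [if_neg (fun h => hb (Fin.ext h))]
      · simp
    · exact Polynomial.natDegree_sum_le_of_forall_le _ _ fun a _ =>
        (Polynomial.natDegree_monomial_le _).trans a.is_le
    · have := congrArg (eval x) hrel
      simp only [map_sum, smul_eval, map_zero, P, map_mul, map_pow, map_prod, hx,
        Fintype.sum_prod_type] at this
      simp only [q, Polynomial.eval_finsetSum, Polynomial.eval_monomial, hpe]
      rw [← this]
      refine Finset.sum_congr rfl fun a _ => ?_
      rw [Finset.sum_mul]
      exact Finset.sum_congr rfl fun b _ => by ring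


/-- If every system `f = c` with small positive right-hand side has a solution in each of a family of
disjoint sets, then the family is small. -/
theorem card_le_of_forall_exists_eval_eq {σ ι : Type*} [Fintype σ] {D : ℕ}
    (f : σ → MvPolynomial σ ℝ) (hf : ∀ i, (f i).totalDegree ≤ D) (T : Finset ι)
    (U : ι → Set (σ → ℝ)) (hU : (T : Set ι).PairwiseDisjoint U) {ε : ℝ} (hε : 0 < ε)
    (h : ∀ c : σ → ℝ, (∀ i, c i ∈ Set.Ioo 0 ε) → ∀ j ∈ T, ∃ x ∈ U j, ∀ i, eval x (f i) = c i) :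
    T.card ≤ (Fintype.card σ * D + 1) ^ Fintype.card σ := by
  classical
  let e := Fintype.equivFin σ
  let l : ℕ → MvPolynomial σ ℝ := fun s => ∑ i, C ((s : ℝ) ^ (e i : ℕ)) * X i
  have hl (s) : (l s).totalDegree ≤ 1 :=
    totalDegree_finsetSum_le fun i _ => (totalDegree_mul _ _).trans (by rw [totalDegree_C, totalDegree_X])
  choose p hp0 hp using fun s => exists_eliminant f hf (l s) (hl s)
  let K := T.offDiag.card * Fintype.card σ
  obtain ⟨c, hc, hpc⟩ : ∃ c : σ → ℝ, (∀ i, c i ∈ Set.Ioo 0 ε) ∧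
      eval c (∏ s ∈ Finset.range (K + 1), p s) ≠ 0 := by
    by_contra! hcon
    refine Finset.prod_ne_zero_iff.2 (fun s _ => hp0 s)
      (funext_set (p := ∏ s ∈ Finset.range (K + 1), p s) (fun _ => Set.Ioo 0 ε)
        (fun _ => Set.Ioo_infinite hε) fun c hc => ?_)
    rw [hcon c fun i => hc i trivial, map_zero]
  rw [map_prod, Finset.prod_ne_zero_iff] at hpc
  choose! x hxU hx using h c hc
  have hinj : ∀ j ∈ T, ∀ j' ∈ T, j ≠ j' → x j ≠ x j' := fun j hj j' hj' hne heq =>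
    Set.disjoint_left.1 (hU hj hj' hne) (hxU j hj) (heq ▸ hxU j' hj')
  let W : ι × ι → Polynomial ℝ := fun jj =>
    ∑ i, Polynomial.monomial (e i : ℕ) (x jj.1 i - x jj.2 i)
  have hW : ∀ jj ∈ T.offDiag, W jj ≠ 0 := by
    rintro ⟨j, j'⟩ hjj h0
    rw [Finset.mem_offDiag] at hjj
    refine hinj j hjj.1 j' hjj.2.1 hjj.2.2 (_root_.funext fun i => ?_)
    have := congrArg (fun r => Polynomial.coeff r (e i : ℕ)) h0
    simp only [W, Polynomial.finsetSum_coeff, Polynomial.coeff_monomial,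
      Polynomial.coeff_zero] at this
    rw [Finset.sum_eq_single i] at this
    · simpa [sub_eq_zero] using this
    · intro i' _ hi'
      rw [if_neg (fun h => hi' (e.injective (Fin.ext h)))]
    · simp
  obtain ⟨s, hs, hWs⟩ : ∃ s ∈ Finset.range (K + 1), (∏ jj ∈ T.offDiag, W jj).eval (s : ℝ) ≠ 0 := by
    by_contra! hcon
    refine Finset.prod_ne_zero_iff.2 hW (Polynomial.eq_zero_of_natDegree_lt_card_of_eval_eq_zero'
      (∏ jj ∈ T.offDiag, W jj) ((Finset.range (K + 1)).image ((↑) : ℕ → ℝ)) ?_ ?_)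
    · simpa using hcon
    · rw [Finset.card_image_of_injective _ Nat.cast_injective, Finset.card_range]
      refine Nat.lt_succ_of_le ((Polynomial.natDegree_prod_le _ _).trans ?_)
      refine Finset.sum_le_card_nsmul _ _ (Fintype.card σ) fun jj _ => ?_
      exact Polynomial.natDegree_sum_le_of_forall_le _ _ fun i _ =>
        (Polynomial.natDegree_monomial_le _).trans (e i).is_lt.le
  rw [Polynomial.eval_prod, Finset.prod_ne_zero_iff] at hWs
  obtain ⟨q, hq0, hqd, hq⟩ := hp s c (hpc s hs)
  refine le_trans ?_ hqd
  refine le_trans ?_ (Polynomial.card_roots' q)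
  refine le_trans ?_ (Multiset.toFinset_card_le _)
  refine Finset.card_le_card_of_injOn (fun j => eval (x j) (l s)) (fun j hj => ?_)
    fun j hj j' hj' heq => ?_
  · simpa [hq0] using hq (x j) (hx j hj)
  · by_contra hne
    refine hWs (j, j') (Finset.mem_offDiag.2 ⟨hj, hj', hne⟩) ?_
    simp only [l, map_sum, map_mul, eval_C, eval_X] at heq
    simp only [W, Polynomial.eval_finsetSum, Polynomial.eval_monomial, sub_mul,
      Finset.sum_sub_distrib]
    rw [sub_eq_zero]
    simpa only [mul_comm] using heq

/-- A polynomial vanishing in a box but not on its boundary has a square whose gradient takes all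
small positive values inside the box. -/
theorem eventually_exists_eval_pderiv_eq {σ : Type*} [Fintype σ] (R : MvPolynomial σ ℝ)
    {a b z : σ → ℝ} (hz : z ∈ Set.Icc a b) (hRz : eval z R = 0)
    (hR : ∀ x ∈ Set.Icc a b, eval x R = 0 → ∀ i, a i < x i ∧ x i < b i) :
    ∀ᶠ ε : ℝ in nhdsWithin 0 (Set.Ioi 0), ∀ c : σ → ℝ, (∀ i, c i ∈ Set.Ioo 0 ε) →
      ∃ x ∈ {x : σ → ℝ | ∀ i, a i < x i ∧ x i < b i}, ∀ i, eval x (pderiv i (R ^ 2)) = c i := by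
  classical
  have hcont (P : MvPolynomial σ ℝ) : Continuous fun x => eval x P := P.continuous_eval
  obtain ⟨m, hm, hmB⟩ : ∃ m, 0 < m ∧
      ∀ x ∈ Set.Icc a b ∩ ⋃ i, ({x | x i = a i} ∪ {x | x i = b i}), m ≤ eval x (R ^ 2) := by
    refine IsCompact.exists_forall_le' (isCompact_Icc.inter_right (isClosed_iUnion_of_finite
      fun i => ?_)) (hcont _).continuousOn ?_
    · exact (isClosed_eq (continuous_apply i) continuous_const).union
        (isClosed_eq (continuous_apply i) continuous_const)
    · rintro x ⟨hx, hxB⟩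
      obtain ⟨i, hi⟩ := Set.mem_iUnion.1 hxB
      have : eval x R ≠ 0 := fun h0 => by
        have := hR x hx h0 i
        rcases hi with hi | hi
        · exact this.1.ne' hi
        · exact this.2.ne hi
      rw [map_pow]
      positivity
  have hab : 0 ≤ ∑ i, (b i - a i) :=
    Finset.sum_nonneg fun i _ => sub_nonneg.2 ((hz.1 i).trans (hz.2 i))
  filter_upwards [Ioo_mem_nhdsGT (show 0 < m / (∑ i, (b i - a i) + 1) by positivity)]
    with ε hε c hc
  let P : MvPolynomial σ ℝ := R ^ 2 - ∑ j, C (c j) * X j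
  have hP (x) : eval x P = eval x (R ^ 2) - ∑ j, c j * x j := by simp [P]
  obtain ⟨x, hx, hmin⟩ := isCompact_Icc.exists_isMinOn ⟨z, hz⟩ (hcont P).continuousOn
  have hxab : ∀ i, a i < x i ∧ x i < b i := by
    by_contra! hcon
    obtain ⟨i, hi⟩ := hcon
    have hxB : x ∈ ⋃ i, ({x | x i = a i} ∪ {x : σ → ℝ | x i = b i}) := by
      refine Set.mem_iUnion.2 ⟨i, ?_⟩
      rcases (hx.1 i).eq_or_lt with h | h
      · exact Or.inl h.symm
      · exact Or.inr (le_antisymm (hx.2 i) (hi h))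
    have h1 := hmB x ⟨hx, hxB⟩
    have h2 : eval x P ≤ eval z P := hmin hz
    rw [hP, hP, map_pow _ R 2, map_pow _ R 2, hRz] at h2
    rw [map_pow] at h1
    have h3 : ∑ i, c i * x i - ∑ i, c i * z i ≤ ε * ∑ i, (b i - a i) := by
      rw [← Finset.sum_sub_distrib, Finset.mul_sum]
      refine Finset.sum_le_sum fun i _ => ?_
      rw [← mul_sub]
      have h5 : x i - z i ≤ b i - a i := sub_le_sub (hx.2 i) (hz.1 i)
      have h6 : 0 ≤ b i - a i := sub_nonneg.2 ((hz.1 i).trans (hz.2 i))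
      exact (mul_le_mul_of_nonneg_left h5 (hc i).1.le).trans
        (mul_le_mul_of_nonneg_right (hc i).2.le h6)
    have h4 := (lt_div_iff₀ (by positivity)).1 hε.2
    have := hε.1
    nlinarith
  refine ⟨x, hxab, fun i => ?_⟩
  have hloc : IsLocalMin (fun t => eval (Function.update x i t) P) (x i) := by
    filter_upwards [Ioo_mem_nhds (hxab i).1 (hxab i).2] with t ht
    rw [Function.update_eq_self]
    refine hmin ?_
    constructor <;> intro j <;> by_cases hj : j = i
    · subst hj; simpa using ht.1.le
    · simpa [hj] using hx.1 j
    · subst hj; simpa using ht.2.le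
    · simpa [hj] using hx.2 j
  have h0 := hloc.hasDerivAt_eq_zero (hasDerivAt_eval_update P x i)
  have hsum : eval x (pderiv i (∑ j, C (c j) * X j)) = c i := by
    simp [pderiv_X, Pi.single_apply]
  rw [map_sub, map_sub, hsum] at h0
  linarith

/-- The number of boxes with disjoint interiors in which a polynomial vanishes, but not on the boundary,
is bounded in terms of its degree. -/
theorem card_boxes_le {σ ι : Type*} [Fintype σ] {d : ℕ} (R : MvPolynomial σ ℝ)
    (hd : R.totalDegree ≤ d) (T : Finset ι) (a b : ι → σ → ℝ)
    (hU : (T : Set ι).PairwiseDisjoint fun j => {x : σ → ℝ | ∀ i, a j i < x i ∧ x i < b j i})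
    (hz : ∀ j ∈ T, ∃ z ∈ Set.Icc (a j) (b j), eval z R = 0)
    (hR : ∀ j ∈ T, ∀ x ∈ Set.Icc (a j) (b j), eval x R = 0 → ∀ i, a j i < x i ∧ x i < b j i) :
    T.card ≤ (Fintype.card σ * (2 * d) + 1) ^ Fintype.card σ := by
  have h := (Filter.eventually_all_finset T).2 fun j hj => by
    obtain ⟨z, hz, hRz⟩ := hz j hj
    exact eventually_exists_eval_pderiv_eq R hz hRz (hR j hj)
  obtain ⟨ε, hε, hε0⟩ := (h.and self_mem_nhdsWithin).exists
  refine card_le_of_forall_exists_eval_eq (fun i => pderiv i (R ^ 2)) (fun i => ?_) T _ hU hε0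
    fun c hc j hj => hε j hj c hc
  refine (totalDegree_pderiv_le _ _).trans ((totalDegree_pow _ _).trans ?_)
  gcongr

end MvPolynomial

section LatticeFaces

variable {n : ℕ}

/-- The face of the lattice `α ℤⁿ` based at `α v`, of side `α` in the directions of `S`. -/
def latticeFace (α : ℝ) (S : Finset (Fin n)) (v : Fin n → ℤ) : Set (Fin n → ℝ) :=
  {x | (∀ i ∈ S, α * v i ≤ x i ∧ x i ≤ α * (v i + 1)) ∧ ∀ i ∉ S, x i = α * v i}

/-- `Q` vanishes somewhere on the lattice face, but nowhere on its relative boundary. -/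
def VanishesInside (Q : MvPolynomial (Fin n) ℝ) (α : ℝ) (S : Finset (Fin n)) (v : Fin n → ℤ) :
    Prop :=
  (∃ x ∈ latticeFace α S v, MvPolynomial.eval x Q = 0) ∧
    ∀ x ∈ latticeFace α S v, MvPolynomial.eval x Q = 0 →
      ∀ i ∈ S, α * v i < x i ∧ x i < α * (v i + 1)

theorem exists_vanishesInside (Q : MvPolynomial (Fin n) ℝ) (α : ℝ) (S : Finset (Fin n))
    (v : Fin n → ℤ) (h : ∃ x ∈ latticeFace α S v, MvPolynomial.eval x Q = 0) :
    ∃ S' v', VanishesInside Q α S' v' ∧ ∀ i, v' i = v i ∨ i ∈ S ∧ v' i = v i + 1 := by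
  induction S using Finset.strongInduction generalizing v with
  | H S ih =>
  by_cases hv : VanishesInside Q α S v
  · exact ⟨S, v, hv, fun i => Or.inl rfl⟩
  · simp only [VanishesInside, not_and, not_forall] at hv
    obtain ⟨x, hx, hx0, i, hi, hxi⟩ := hv h
    obtain ⟨u, hu, hxu⟩ : ∃ u : ℤ, (u = v i ∨ u = v i + 1) ∧ x i = α * u := by
      have := hx.1 i hi
      by_cases h1 : α * v i < x i
      · exact ⟨v i + 1, Or.inr rfl, by
          push_cast; exact le_antisymm this.2 (not_lt.1 fun h2 => hxi h1 h2)⟩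
      · exact ⟨v i, Or.inl rfl, le_antisymm (not_lt.1 h1) this.1⟩
    obtain ⟨S', v', h1, h2⟩ := ih (S.erase i) (Finset.erase_ssubset hi) (Function.update v i u)
      ⟨x, ⟨fun j hj => by
        rw [Finset.mem_erase] at hj
        simpa [hj.1] using hx.1 j hj.2, fun j hj => by
        by_cases hji : j = i
        · subst hji; simpa using hxu
        · simpa [hji] using hx.2 j fun hjS => hj (Finset.mem_erase.2 ⟨hji, hjS⟩)⟩, hx0⟩
    refine ⟨S', v', h1, fun j => ?_⟩
    have h3 := h2 j
    by_cases hji : j = i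
    · subst hji
      simp only [Function.update_self, Finset.mem_erase, ne_eq, not_true_eq_false, false_and,
        or_false] at h3
      rw [h3]
      exact hu.imp id fun h => ⟨hi, h⟩
    · simp only [Function.update_of_ne hji, Finset.mem_erase] at h3
      exact h3.imp id fun h => ⟨h.1.2, h.2⟩

open Classical in
theorem card_vanishesInside_empty_le (Q : MvPolynomial (Fin n) ℝ) (hQ : Q ≠ 0) {d : ℕ}
    (hd : Q.totalDegree ≤ d) (hn : 1 ≤ n) {α : ℝ} (hα : 0 < α) (I : Finset ℤ) :
    ((Fintype.piFinset fun _ : Fin n => I).filter (VanishesInside Q α ∅)).card ≤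
      d * I.card ^ (n - 1) := by
  have hinj : Function.Injective fun u : ℤ => α * (u : ℝ) := fun u w h =>
    Int.cast_injective (mul_left_cancel₀ hα.ne' h)
  have hSZ := MvPolynomial.schwartz_zippel_totalDegree hQ (I.image fun u : ℤ => α * (u : ℝ))
  rw [Finset.card_image_of_injective _ hinj] at hSZ
  set F := (Fintype.piFinset fun _ : Fin n => I.image fun u : ℤ => α * (u : ℝ)).filter
    fun x => MvPolynomial.eval x Q = 0
  have hle : ((Fintype.piFinset fun _ : Fin n => I).filter (VanishesInside Q α ∅)).card ≤
      F.card := by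
    refine Finset.card_le_card_of_injOn (fun v i => α * (v i : ℝ)) (fun v hv => ?_)
      fun v _ w _ h => funext fun i => hinj (congrFun h i)
    rw [Finset.mem_coe, Finset.mem_filter, Fintype.mem_piFinset] at hv
    obtain ⟨hvI, ⟨x, hx, hx0⟩, -⟩ := hv
    have : x = fun i => α * (v i : ℝ) := funext fun i => hx.2 i (by simp)
    rw [Finset.mem_coe, Finset.mem_filter, Fintype.mem_piFinset]
    rw [this] at hx0
    exact ⟨fun i => Finset.mem_image_of_mem _ (hvI i), hx0⟩
  refine hle.trans ?_
  rcases I.eq_empty_or_nonempty with rfl | hI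
  · have : F = ∅ := by
      refine Finset.eq_empty_of_forall_notMem fun x hx => ?_
      have := Fintype.mem_piFinset.1 (Finset.mem_filter.1 hx).1 ⟨0, hn⟩
      simp at this
    simp [this]
  · have hIpos : (0 : ℚ≥0) < I.card := by exact_mod_cast hI.card_pos
    rw [div_le_iff₀ (by positivity)] at hSZ
    have h2 : ((F.card : ℕ) : ℚ≥0) ≤ ((d * I.card ^ (n - 1) : ℕ) : ℚ≥0) := by
      refine hSZ.trans ?_
      obtain ⟨k, rfl⟩ : ∃ k, n = k + 1 := ⟨n - 1, by omega⟩
      rw [pow_succ, div_mul_eq_mul_div, ← mul_assoc, mul_div_cancel_right₀ _ hIpos.ne']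
      push_cast
      gcongr
    exact_mod_cast h2

open Classical in
theorem card_vanishesInside_le (Q : MvPolynomial (Fin n) ℝ) {d : ℕ}
    (hd : Q.totalDegree ≤ d) {α : ℝ} (hα : 0 < α) (S : Finset (Fin n)) (I : Finset ℤ) :
    ((Fintype.piFinset fun _ : Fin n => I).filter (VanishesInside Q α S)).card ≤
      (S.card * (2 * d) + 1) ^ S.card * I.card ^ (n - S.card) := by
  set T := (Fintype.piFinset fun _ : Fin n => I).filter (VanishesInside Q α S)
  let r : (Fin n → ℤ) → {i // i ∉ S} → ℤ := fun v i => v i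
  have himage : (T.image r).card ≤ I.card ^ (n - S.card) := by
    have hsub : T.image r ⊆ Fintype.piFinset fun _ => I := by
      intro w hw
      obtain ⟨v, hv, rfl⟩ := Finset.mem_image.1 hw
      exact Fintype.mem_piFinset.2 fun i =>
        Fintype.mem_piFinset.1 (Finset.mem_filter.1 hv).1 i
    refine (Finset.card_le_card hsub).trans_eq ?_
    rw [Fintype.card_piFinset, Finset.prod_const]
    congr 1
    simp [Fintype.card_subtype_compl]
  refine (Finset.card_le_mul_card_image (f := r) T _ fun w _ => ?_).trans
    (Nat.mul_le_mul_left _ himage)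
  let R : MvPolynomial S ℝ := MvPolynomial.aeval
    (fun i => if h : i ∈ S then MvPolynomial.X ⟨i, h⟩ else MvPolynomial.C (α * w ⟨i, h⟩)) Q
  let g : (S → ℝ) → Fin n → ℝ := fun y i => if h : i ∈ S then y ⟨i, h⟩ else α * w ⟨i, h⟩
  have hR (y) : MvPolynomial.eval y R = MvPolynomial.eval (g y) Q := by
    simp only [R, MvPolynomial.aeval_def, MvPolynomial.algebraMap_eq]
    rw [← MvPolynomial.coe_eval₂Hom, ← RingHom.comp_apply, ← MvPolynomial.eval₂_id,
      ← MvPolynomial.coe_eval₂Hom]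
    congr 1
    ext i
    · simp
    · by_cases h : i ∈ S <;> simp [g, h]
  have hRd : R.totalDegree ≤ d := by
    refine (MvPolynomial.totalDegree_aeval_le _ (fun i => ?_) Q).trans hd
    by_cases h : i ∈ S
    · simp [h]
    · simp only [h, dite_false, MvPolynomial.totalDegree_C, zero_le]
  have hface {v} (hv : v ∈ T.filter fun v => r v = w) {y : S → ℝ}
      (hy : y ∈ Set.Icc (fun i : S => α * (v i : ℝ)) fun i : S => α * ((v i : ℝ) + 1)) :
      g y ∈ latticeFace α S v := by
    refine ⟨fun i hi => ?_, fun i hi => ?_⟩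
    · simpa [g, hi] using And.intro (hy.1 ⟨i, hi⟩) (hy.2 ⟨i, hi⟩)
    · simp only [g, hi, dite_false]
      rw [← (Finset.mem_filter.1 hv).2]
  have key := MvPolynomial.card_boxes_le R hRd (T.filter fun v => r v = w)
    (fun v i => α * (v i : ℝ)) (fun v i => α * ((v i : ℝ) + 1)) ?_ (fun v hv => ?_) ?_
  · simpa using key
  · intro v hv v' hv' hne
    refine Set.disjoint_left.2 fun y hy hy' => hne (funext fun i => ?_)
    have hrv := (Finset.mem_filter.1 hv).2.trans (Finset.mem_filter.1 hv').2.symm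
    by_cases hi : i ∈ S
    · have h1 := hy ⟨i, hi⟩
      have h2 := hy' ⟨i, hi⟩
      have h3 := lt_of_mul_lt_mul_left (h1.1.trans h2.2) hα.le
      have h4 := lt_of_mul_lt_mul_left (h2.1.trans h1.2) hα.le
      norm_cast at h3 h4
      simp only at h3 h4
      omega
    · exact congrFun hrv ⟨i, hi⟩
  · obtain ⟨x, hx, hx0⟩ := (Finset.mem_filter.1 (Finset.mem_filter.1 hv).1).2.1
    refine ⟨fun i => x i, ⟨fun i => (hx.1 i i.2).1, fun i => (hx.1 i i.2).2⟩, ?_⟩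
    rw [hR]
    convert hx0
    ext i
    by_cases hi : i ∈ S
    · simp [g, hi]
    · simp only [g, hi, dite_false]
      rw [hx.2 i hi, ← (Finset.mem_filter.1 hv).2]
  · intro v hv y hy hy0 i
    rw [hR] at hy0
    simpa [g] using
      (Finset.mem_filter.1 (Finset.mem_filter.1 hv).1).2.2 (g y) (hface hv hy) hy0 i i.2

open Classical in
theorem card_vanishesInside_le_uniform (Q : MvPolynomial (Fin n) ℝ) (hQ : Q ≠ 0) {d : ℕ}
    (hd : Q.totalDegree ≤ d) (hd0 : 0 < d) (hn : 1 ≤ n) {α : ℝ} (hα : 0 < α)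
    (S : Finset (Fin n)) (I : Finset ℤ) (hI : d ≤ I.card) :
    ((Fintype.piFinset fun _ : Fin n => I).filter (VanishesInside Q α S)).card ≤
      (3 * n) ^ n * d * I.card ^ (n - 1) := by
  rcases S.eq_empty_or_nonempty with rfl | hS
  · refine (card_vanishesInside_empty_le Q hQ hd hn hα I).trans ?_
    gcongr
    exact Nat.le_mul_of_pos_left _ (by positivity)
  · refine (card_vanishesInside_le Q hd hα S I).trans ?_
    have hSn : S.card ≤ n := by simpa using Finset.card_le_univ S
    obtain ⟨k, hk⟩ : ∃ k, S.card = k + 1 := ⟨S.card - 1, by have := hS.card_pos; omega⟩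
    calc (S.card * (2 * d) + 1) ^ S.card * I.card ^ (n - S.card)
        ≤ (3 * n * d) ^ S.card * I.card ^ (n - S.card) := by
          gcongr
          nlinarith [Nat.mul_le_mul_right d hSn, Nat.mul_le_mul hn hd0]
      _ = (3 * n) ^ S.card * d * (d ^ k * I.card ^ (n - S.card)) := by
          rw [mul_pow, hk, pow_succ d]; ring
      _ ≤ (3 * n) ^ n * d * (I.card ^ k * I.card ^ (n - S.card)) := by
          gcongr
          omega
      _ = (3 * n) ^ n * d * I.card ^ (n - 1) := by
          rw [← pow_add]; congr 2; omega

end LatticeFaces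

/-- Wongkew's theorem: a low degree polynomial cannot have a dense zero set.
For every `n ≥ 1` there is `C_n > 0` such that for `0 < α < 1`, `d ≥ 1` and any
nonzero polynomial `Q` of total degree at most `d` in `n` real variables, the part
of the `α`-neighborhood of the zero set of `Q` inside the unit cube `[0,1]^n` has
Lebesgue measure at most `C_n · α · d`. (The distance to the empty set is `+∞`,
so the condition fails if the zero set is empty.) -/
theorem volume_nbhd_zero_set_le
    (n : ℕ) (hn : 1 ≤ n) :
    ∃ C : ℝ, 0 < C ∧
      ∀ (α : ℝ), 0 < α → α < 1 →
        ∀ d : ℕ, 0 < d →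
          ∀ Q : MvPolynomial (Fin n) ℝ, Q ≠ 0 → Q.totalDegree ≤ d →
            volume {x : EuclideanSpace ℝ (Fin n) |
                (∀ i, x i ∈ Set.Icc (0 : ℝ) 1) ∧
                EMetric.infEdist x
                  {y : EuclideanSpace ℝ (Fin n) |
                    MvPolynomial.eval (fun i => y i) Q = 0} ≤ ENNReal.ofReal α}
              ≤ ENNReal.ofReal (C * α * d) := by
  classical
  have hn' : (1 : ℝ) ≤ n := by exact_mod_cast hn
  have hbox (a b : Fin n → ℝ) :
      volume {x : EuclideanSpace ℝ (Fin n) | ∀ i, x i ∈ Set.Icc (a i) (b i)} =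
        ∏ i, ENNReal.ofReal (b i - a i) := by
    rw [← Real.volume_Icc_pi, ← (PiLp.volume_preserving_ofLp (Fin n)).measure_preimage
      measurableSet_Icc.nullMeasurableSet]
    congr 1
    ext x
    simp [Pi.le_def, forall_and]
  refine ⟨(252 * n) ^ n, by positivity, fun α hα hα1 d hd0 Q hQ hd => ?_⟩
  rcases lt_or_ge 1 (α * d) with hαd | hαd
  · calc _ ≤ volume {x : EuclideanSpace ℝ (Fin n) | ∀ i, x i ∈ Set.Icc (0 : ℝ) 1} :=
          measure_mono fun x hx => hx.1
      _ = 1 := by rw [hbox]; simp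
      _ ≤ _ := by
        rw [ENNReal.one_le_ofReal, mul_assoc]
        have : (1 : ℝ) ≤ (252 * n) ^ n := one_le_pow₀ (by linarith)
        nlinarith
  let I : Finset ℤ := Finset.Icc (-2) (⌊1 / α⌋ + 3)
  have hfloor : 0 ≤ ⌊1 / α⌋ := Int.floor_nonneg.2 (by positivity)
  have hIcard : (I.card : ℝ) = ⌊1 / α⌋ + 6 := by
    have : (I.card : ℤ) = ⌊1 / α⌋ + 6 := by
      simp only [I, Int.card_Icc]
      omega
    exact_mod_cast this
  have hdI : d ≤ I.card := by
    have h1 : (d : ℝ) ≤ 1 / α := by rw [le_div_iff₀ hα]; linarith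
    have h2 := Int.lt_floor_add_one (1 / α)
    have : (d : ℝ) ≤ I.card := by rw [hIcard]; linarith
    exact_mod_cast this
  have hαI : α * I.card ≤ 7 := by
    have h1 : α * ⌊1 / α⌋ ≤ α * (1 / α) := mul_le_mul_of_nonneg_left (Int.floor_le _) hα.le
    rw [mul_one_div_cancel hα.ne'] at h1
    rw [hIcard]
    linarith
  let G : Finset (Fin n) → Finset (Fin n → ℤ) := fun S =>
    (Fintype.piFinset fun _ : Fin n => I).filter (VanishesInside Q α S)
  let B : (Fin n → ℤ) → Set (EuclideanSpace ℝ (Fin n)) := fun v =>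
    {x | ∀ i, x i ∈ Set.Icc (α * (v i - 3)) (α * (v i + 3))}
  have hB (v) : volume (B v) = ENNReal.ofReal ((6 * α) ^ n) := by
    simp only [B]
    rw [hbox, ENNReal.ofReal_pow (by positivity)]
    simp only [show ∀ i, α * ((v i : ℝ) + 3) - α * (v i - 3) = 6 * α from fun i => by ring]
    simp
  have hcover : {x : EuclideanSpace ℝ (Fin n) | (∀ i, x i ∈ Set.Icc (0 : ℝ) 1) ∧
      Metric.infEDist x {y : EuclideanSpace ℝ (Fin n) |
        MvPolynomial.eval (fun i => y i) Q = 0} ≤ ENNReal.ofReal α} ⊆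
      ⋃ S ∈ (Finset.univ : Finset (Finset (Fin n))), ⋃ v ∈ G S, B v := by
    rintro x ⟨hx, hxd⟩
    have hlt := hxd.trans_lt ((ENNReal.ofReal_lt_ofReal_iff (by positivity)).2
      (show α < 2 * α by linarith))
    obtain ⟨z, hz, hxz⟩ := Metric.infEDist_lt_iff.1 hlt
    rw [edist_dist, ENNReal.ofReal_lt_ofReal_iff (by positivity)] at hxz
    have hxzi (i) : |x i - z i| < 2 * α := by
      have := PiLp.norm_apply_le (x - z) i
      rw [← dist_eq_norm] at this
      exact this.trans_lt hxz
    let v : Fin n → ℤ := fun i => ⌊z i / α⌋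
    have hv1 (i) : α * v i ≤ z i := by
      have := (le_div_iff₀ hα).1 (Int.floor_le (z i / α))
      simp only [v]; linarith
    have hv2 (i) : z i < α * (v i + 1) := by
      have := (div_lt_iff₀ hα).1 (Int.lt_floor_add_one (z i / α))
      simp only [v]; linarith
    obtain ⟨S, v', hv', hvv'⟩ := exists_vanishesInside Q α Finset.univ v
      ⟨fun i => z i, ⟨fun i _ => ⟨hv1 i, (hv2 i).le⟩,
        fun i hi => absurd (Finset.mem_univ i) hi⟩, hz⟩
    have hvZ (i) : v i ≤ v' i ∧ v' i ≤ v i + 1 := by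
      rcases hvv' i with h | h <;> omega
    refine Set.mem_biUnion (Finset.mem_univ S) (Set.mem_biUnion (x := v')
      (Finset.mem_filter.2 ⟨Fintype.mem_piFinset.2 fun i => ?_, hv'⟩) fun i => ?_)
    · have hxi := hx i
      have habs := abs_lt.1 (hxzi i)
      have h1 : -2 ≤ v i := by
        refine Int.le_floor.2 ((le_div_iff₀ hα).2 ?_)
        push_cast
        linarith [hxi.1]
      have h2 : v i ≤ ⌊1 / α⌋ + 2 := by
        have : z i / α ≤ 1 / α + (2 : ℤ) := by
          rw [div_le_iff₀ hα, add_mul, one_div_mul_cancel hα.ne']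
          push_cast
          linarith [hxi.2]
        refine (Int.floor_mono this).trans_eq ?_
        rw [Int.floor_add_intCast]
      have := hvZ i
      exact Finset.mem_Icc.2 ⟨by omega, by omega⟩
    · have habs := abs_lt.1 (hxzi i)
      have h1 : (v i : ℝ) ≤ v' i := by exact_mod_cast (hvZ i).1
      have h2 : (v' i : ℝ) ≤ v i + 1 := by exact_mod_cast (hvZ i).2
      have := hv1 i
      have := hv2 i
      constructor <;> nlinarith
  calc _ ≤ ∑ S : Finset (Fin n), ∑ v ∈ G S, volume (B v) :=
        (measure_mono hcover).trans ((measure_biUnion_finset_le _ _).trans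
          (Finset.sum_le_sum fun S _ => measure_biUnion_finset_le _ _))
    _ = ((∑ S : Finset (Fin n), (G S).card : ℕ) : ENNReal) * ENNReal.ofReal ((6 * α) ^ n) := by
        simp only [hB, Finset.sum_const, nsmul_eq_mul, Nat.cast_sum, Finset.sum_mul]
    _ ≤ ((2 ^ n * ((3 * n) ^ n * d * I.card ^ (n - 1)) : ℕ) : ENNReal) *
          ENNReal.ofReal ((6 * α) ^ n) := by
        gcongr
        refine (Finset.sum_le_card_nsmul _ _ _ fun S _ =>
          card_vanishesInside_le_uniform Q hQ hd hd0 hn hα S I hdI).trans_eq ?_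
        simp
    _ ≤ _ := by
        rw [← ENNReal.ofReal_natCast, ← ENNReal.ofReal_mul (Nat.cast_nonneg _)]
        refine ENNReal.ofReal_le_ofReal ?_
        push_cast
        have h1 : (α * I.card) ^ (n - 1) ≤ 7 ^ n :=
          (pow_le_pow_left₀ (by positivity) hαI _).trans
            (pow_le_pow_right₀ (by norm_num) (Nat.sub_le _ _))
        have h2 : α ^ n = α ^ (n - 1) * α := by
          rw [← pow_succ, Nat.sub_add_cancel hn]
        calc _ = (36 * n : ℝ) ^ n * (α * I.card) ^ (n - 1) * (α * d) := by
              rw [mul_pow α, mul_pow 6 α, h2, show (36 * n : ℝ) = 2 * (3 * n) * 6 by ring,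
                mul_pow _ (6 : ℝ), mul_pow (2 : ℝ)]
              ring
          _ ≤ (36 * n : ℝ) ^ n * 7 ^ n * (α * d) := by gcongr
          _ = _ := by rw [← mul_pow]; ring
end

section
/- For every integer n ≥ 1 there exists a constant C_n > 0 such that for every finite set P ⊆ ℝ^n and every positive integer D, there exists a nonzero polynomial Q in n real variables of total degree at most D such that every connected component U of the complement ℝ^n \ Z(Q) of the zero set Z(Q) = {x : Q(x) = 0} satisfies |P ∩ U| ≤ C_n·|P|/D^n. -/
section RandomHalfspace

open MeasureTheory ProbabilityTheory

lemma gaussianReal_abs_le_measure_le (r : ℝ) :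
    gaussianReal 0 1 {b : ℝ | |b| ≤ r} ≤ ENNReal.ofReal r := by
  have hpdf : ∀ x : ℝ, gaussianPDF 0 1 x ≤ ENNReal.ofReal (1 / 2) := by
    intro x
    refine ENNReal.ofReal_le_ofReal ?_
    rw [gaussianPDFReal_def]
    have hsqrt : (2 : ℝ) ≤ √(2 * Real.pi * (1 : NNReal)) := by
      apply Real.le_sqrt_of_sq_le
      have := Real.pi_gt_three
      norm_num
      linarith
    have hexp : Real.exp (-(x - 0) ^ 2 / (2 * (1 : NNReal))) ≤ 1 := by
      rw [Real.exp_le_one_iff]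
      have := sq_nonneg (x - 0)
      simp only [NNReal.coe_one]
      linarith
    calc _ ≤ (√(2 * Real.pi * (1 : NNReal)))⁻¹ * 1 :=
          mul_le_mul_of_nonneg_left hexp (by positivity)
      _ ≤ 1 / 2 := by
        rw [mul_one, one_div]
        exact inv_anti₀ two_pos hsqrt
  have hset : {b : ℝ | |b| ≤ r} = Set.Icc (-r) r := by
    ext b; simp [abs_le]
  rw [gaussianReal_apply 0 one_ne_zero]
  calc ∫⁻ x in {b : ℝ | |b| ≤ r}, gaussianPDF 0 1 x
      ≤ ∫⁻ _ in {b : ℝ | |b| ≤ r}, ENNReal.ofReal (1 / 2) := lintegral_mono fun x => hpdf x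
    _ = ENNReal.ofReal r := by
        rw [setLIntegral_const, hset, Real.volume_Icc, ← ENNReal.ofReal_mul (by norm_num)]
        congr 1; ring

lemma lintegral_abs_gaussianReal_le :
    ∫⁻ a, ENNReal.ofReal |a| ∂(gaussianReal 0 1) ≤ ENNReal.ofReal 2 := by
  have hL2 : MemLp id 2 (gaussianReal 0 1) := memLp_id_gaussianReal 2
  have hint : Integrable (fun a : ℝ => a ^ 2) (gaussianReal 0 1) := hL2.integrable_sq
  have hvar : ∫ a, a ^ 2 ∂(gaussianReal 0 1) = 1 := by
    have h1 := variance_id_gaussianReal (μ := 0) (v := 1)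
    rw [variance_of_integral_eq_zero aemeasurable_id (by simp)] at h1
    simpa using h1
  calc ∫⁻ a, ENNReal.ofReal |a| ∂(gaussianReal 0 1)
      ≤ ∫⁻ a, ENNReal.ofReal (1 + a ^ 2) ∂(gaussianReal 0 1) := by
        refine lintegral_mono fun a => ENNReal.ofReal_le_ofReal ?_
        rw [← sq_abs a]
        nlinarith [sq_nonneg (|a| - 1)]
    _ = ENNReal.ofReal (∫ a, (1 + a ^ 2) ∂(gaussianReal 0 1)) := by
        refine (ofReal_integral_eq_lintegral_ofReal ((integrable_const 1).add hint) ?_).symm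
        exact Filter.Eventually.of_forall fun a => add_nonneg zero_le_one (sq_nonneg a)
    _ = ENNReal.ofReal 2 := by
        rw [integral_add (integrable_const 1) hint, hvar]
        norm_num

lemma gaussianReal_prod_abs_le_mul_abs (τ : ℝ) (hτ : 0 ≤ τ) :
    ((gaussianReal 0 1).prod (gaussianReal 0 1)) {p : ℝ × ℝ | |p.2| ≤ τ * |p.1|}
      ≤ ENNReal.ofReal (2 * τ) := by
  have hmeas : MeasurableSet {p : ℝ × ℝ | |p.2| ≤ τ * |p.1|} :=
    measurableSet_le (by fun_prop) (by fun_prop)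
  rw [Measure.prod_apply hmeas]
  calc _ ≤ ∫⁻ a, ENNReal.ofReal τ * ENNReal.ofReal |a| ∂(gaussianReal 0 1) := by
        refine lintegral_mono fun a => ?_
        rw [← ENNReal.ofReal_mul hτ]
        exact gaussianReal_abs_le_measure_le (τ * |a|)
    _ ≤ ENNReal.ofReal τ * ENNReal.ofReal 2 := by
        rw [lintegral_const_mul _ (by fun_prop)]
        gcongr
        exact lintegral_abs_gaussianReal_le
    _ = ENNReal.ofReal (2 * τ) := by
        rw [← ENNReal.ofReal_mul hτ, mul_comm]

lemma gaussianReal_prod_mul_pos_le :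
    ((gaussianReal 0 1).prod (gaussianReal 0 1)) {p : ℝ × ℝ | 0 < p.1 * p.2}
      ≤ ENNReal.ofReal (1 / 2) := by
  set μ := (gaussianReal 0 1).prod (gaussianReal 0 1)
  have hneg : MeasurePreserving (fun x : ℝ => -x) (gaussianReal 0 1) (gaussianReal 0 1) :=
    ⟨measurable_neg, by rw [gaussianReal_map_neg, neg_zero]⟩
  have hflip : MeasurePreserving (Prod.map id fun x : ℝ => -x) μ μ :=
    (MeasurePreserving.id _).prod hneg
  have hpos : MeasurableSet {p : ℝ × ℝ | 0 < p.1 * p.2} :=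
    measurableSet_lt (by fun_prop) (by fun_prop)
  have hltz : MeasurableSet {p : ℝ × ℝ | p.1 * p.2 < 0} :=
    measurableSet_lt (by fun_prop) (by fun_prop)
  have heq : μ {p : ℝ × ℝ | p.1 * p.2 < 0} = μ {p : ℝ × ℝ | 0 < p.1 * p.2} := by
    rw [← hflip.measure_preimage hpos.nullMeasurableSet]
    congr 1
    ext p
    simp
  have hdisj : Disjoint {p : ℝ × ℝ | p.1 * p.2 < 0} {p : ℝ × ℝ | 0 < p.1 * p.2} := by
    rw [Set.disjoint_left]
    intro p h1 h2
    rw [Set.mem_ofPred_eq] at h1 h2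
    exact lt_asymm h1 h2
  have hsum := measure_union hdisj hpos (μ := μ)
  have hle : μ {p : ℝ × ℝ | 0 < p.1 * p.2} + μ {p : ℝ × ℝ | 0 < p.1 * p.2} ≤ 1 := by
    rw [heq] at hsum
    rw [← hsum]
    exact prob_le_one
  rw [← two_mul] at hle
  rw [one_div, ENNReal.ofReal_inv_of_pos two_pos, ENNReal.ofReal_ofNat,
    ENNReal.le_inv_iff_mul_le, mul_comm]
  exact hle

variable {E : Type*} [NormedAddCommGroup E] [InnerProductSpace ℝ E] [FiniteDimensional ℝ E]
  [MeasurableSpace E] [BorelSpace E]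

lemma stdGaussian_map_inner {u : E} (hu : ‖u‖ = 1) :
    (stdGaussian E).map (fun g => inner ℝ u g) = gaussianReal 0 1 := by
  have h : HasGaussianLaw (fun g : E => inner ℝ u g) (stdGaussian E) :=
    (IsGaussian.hasGaussianLaw_id (μ := stdGaussian E)).map (innerSL ℝ u)
  rw [h.map_eq_gaussianReal]
  have h1 := integral_strongDual_stdGaussian (innerSL ℝ u)
  have h2 := variance_dual_stdGaussian (innerSL ℝ u)
  rw [innerSL_apply_norm, hu, one_pow] at h2
  simp only [innerSL_apply_apply] at h1
  rw [h1]
  have h2' : Var[fun g => inner ℝ u g; stdGaussian E] = 1 := h2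
  rw [h2', Real.toNNReal_one]

lemma stdGaussian_map_inner_prod {u e : E} (hu : ‖u‖ = 1) (he : ‖e‖ = 1) (hue : inner ℝ u e = 0) :
    (stdGaussian E).map (fun g => (inner ℝ u g, inner ℝ e g)) =
      (gaussianReal 0 1).prod (gaussianReal 0 1) := by
  have h : HasGaussianLaw (fun g : E => (inner ℝ u g, inner ℝ e g)) (stdGaussian E) :=
    (IsGaussian.hasGaussianLaw_id (μ := stdGaussian E)).map ((innerSL ℝ u).prod (innerSL ℝ e))
  have hcov : cov[fun g => inner ℝ u g, fun g => inner ℝ e g; stdGaussian E] = 0 := by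
    rw [← covarianceBilin_apply_eq_cov IsGaussian.memLp_two_id, covarianceBilin_stdGaussian]
    exact hue
  have hind := h.indepFun_of_covariance_eq_zero hcov
  rw [indepFun_iff_map_prod_eq_prod_map_map (by fun_prop) (by fun_prop)] at hind
  rw [hind, stdGaussian_map_inner hu, stdGaussian_map_inner he]

/-- Two unit vectors lie strictly on the same side of a random hyperplane with probability
exceeding `1 / 2` by at most a constant times the absolute value of their inner product. -/
lemma stdGaussian_same_side_le {u w : E} (hu : ‖u‖ = 1) (hw : ‖w‖ = 1) :
    (stdGaussian E).real {g | 0 < inner ℝ u g * inner ℝ w g} ≤ 1 / 2 + 4 * |inner ℝ u w| := by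
  set t : ℝ := inner ℝ u w with ht
  rcases le_or_gt (1 / 2) |t| with hbig | hsmall
  · have : (stdGaussian E).real {g | 0 < inner ℝ u g * inner ℝ w g} ≤ 1 := measureReal_le_one
    linarith
  set d : E := w - t • u with hd
  have hnorm : ‖d‖ ^ 2 = 1 - t ^ 2 := by
    rw [hd, norm_sub_sq_real, inner_smul_right, real_inner_comm, ← ht, norm_smul, hu, hw,
      Real.norm_eq_abs, mul_one, sq_abs]
    ring
  have hs : (1 / 2 : ℝ) ≤ ‖d‖ := by
    have h1 := abs_lt.mp hsmall
    nlinarith [norm_nonneg d]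
  have hs0 : ‖d‖ ≠ 0 := by linarith
  set e : E := ‖d‖⁻¹ • d with he
  have hde : d = ‖d‖ • e := by rw [he, smul_smul, mul_inv_cancel₀ hs0, one_smul]
  have hnorme : ‖e‖ = 1 := by
    rw [he, norm_smul, norm_inv, norm_norm, inv_mul_cancel₀ hs0]
  have hort : inner ℝ u e = 0 := by
    rw [he, inner_smul_right, hd, inner_sub_right, inner_smul_right, real_inner_self_eq_norm_sq, hu,
      ← ht]
    ring
  have hw' : ∀ g : E, inner ℝ w g = t * inner ℝ u g + ‖d‖ * inner ℝ e g := by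
    intro g
    have : w = t • u + ‖d‖ • e := by rw [← hde, hd]; abel
    conv_lhs => rw [this]
    simp [inner_add_left, inner_smul_left]
  set S1 : Set (ℝ × ℝ) := {p | 0 < p.1 * p.2} with hS1
  set S2 : Set (ℝ × ℝ) := {p | |p.2| ≤ (2 * |t|) * |p.1|} with hS2
  have hm : MeasurableSet (S1 ∪ S2) :=
    (measurableSet_lt (by fun_prop) (by fun_prop)).union
      (measurableSet_le (by fun_prop) (by fun_prop))
  have hsub : {g | 0 < inner ℝ u g * inner ℝ w g} ⊆
      (fun g : E => ((inner ℝ u g : ℝ), (inner ℝ e g : ℝ))) ⁻¹' (S1 ∪ S2) := by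
    intro g hg
    simp only [Set.mem_ofPred_eq, hw'] at hg
    by_contra hcon
    simp only [Set.mem_preimage, Set.mem_union, hS1, hS2, Set.mem_ofPred_eq, not_or, not_lt,
      not_le] at hcon
    obtain ⟨h1, h2⟩ := hcon
    generalize (inner ℝ u g : ℝ) = a at *
    generalize (inner ℝ e g : ℝ) = b at *
    have hab : |a * b| = -(a * b) := abs_of_nonpos h1
    have h3 : a * (t * a + ‖d‖ * b) = t * a ^ 2 - ‖d‖ * |a * b| := by rw [hab]; ring
    have h4 : t * a ^ 2 ≤ |t| * |a| ^ 2 := by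
      rw [sq_abs]; exact mul_le_mul_of_nonneg_right (le_abs_self t) (sq_nonneg a)
    have h5 : |t| * |a| ^ 2 ≤ ‖d‖ * |a * b| := by
      rw [abs_mul]
      have h6 : |a| * (2 * |t| * |a|) ≤ |a| * |b| :=
        mul_le_mul_of_nonneg_left h2.le (abs_nonneg a)
      nlinarith [mul_nonneg (abs_nonneg a) (abs_nonneg b)]
    linarith
  have hmeasure : (stdGaussian E) {g | 0 < inner ℝ u g * inner ℝ w g} ≤
      ENNReal.ofReal (1 / 2 + 4 * |t|) := by
    calc _ ≤ (stdGaussian E)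
          ((fun g : E => ((inner ℝ u g : ℝ), (inner ℝ e g : ℝ))) ⁻¹' (S1 ∪ S2)) :=
          measure_mono hsub
      _ = ((gaussianReal 0 1).prod (gaussianReal 0 1)) (S1 ∪ S2) := by
          rw [← stdGaussian_map_inner_prod hu hnorme hort, Measure.map_apply (by fun_prop) hm]
      _ ≤ ENNReal.ofReal (1 / 2) + ENNReal.ofReal (2 * (2 * |t|)) :=
          (measure_union_le _ _).trans (add_le_add gaussianReal_prod_mul_pos_le
            (gaussianReal_prod_abs_le_mul_abs _ (by positivity)))
      _ = ENNReal.ofReal (1 / 2 + 4 * |t|) := by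
          rw [← ENNReal.ofReal_add (by norm_num) (by positivity)]
          congr 1; ring
  exact ENNReal.toReal_le_of_le_ofReal (by positivity) hmeasure

end RandomHalfspace

section IsotropicPosition

variable {V ι κ : Type*} [NormedAddCommGroup V] [InnerProductSpace ℝ V] [Fintype ι]
  [DecidableEq ι] [Fintype κ]

lemma norm_sub_half_inner_smul_sq {e w : V} (he : ‖e‖ = 1) :
    ‖w - ((1 / 2 : ℝ) * inner ℝ e w) • e‖ ^ 2 = ‖w‖ ^ 2 - 3 / 4 * (inner ℝ e w) ^ 2 := by
  rw [norm_sub_sq_real, inner_smul_right, norm_smul, he, Real.norm_eq_abs, mul_one, sq_abs,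
    real_inner_comm]
  ring

variable [FiniteDimensional ℝ V]

lemma exists_abs_det_pow_le (b : Module.Basis ι ℝ V) (v : κ × ι → V)
    (hv : ∀ a, b.det (fun i => v (a, i)) ≠ 0) :
    ∃ K : ℝ, ∀ B : V →ₗ[ℝ] V,
      |LinearMap.det B| ^ Fintype.card κ ≤ K * ∏ x, ‖B (v x)‖ := by
  have hcont : Continuous b.det.toMultilinearMap := by
    change Continuous fun w : ι → V => (b.toMatrix w).det
    refine Continuous.matrix_det (continuous_matrix fun i j => ?_)
    exact (LinearMap.continuous_of_finiteDimensional (b.coord i)).comp (continuous_apply j)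
  obtain ⟨K, hK, hbound⟩ := MultilinearMap.exists_bound_of_continuous b.det.toMultilinearMap hcont
  refine ⟨∏ a, (|b.det (fun i => v (a, i))|⁻¹ * K), fun B => ?_⟩
  rw [Fintype.prod_prod_type, ← Finset.prod_mul_distrib, ← Finset.card_univ,
    ← Finset.prod_const]
  refine Finset.prod_le_prod (fun _ _ => abs_nonneg _) fun a _ => ?_
  have h1 := hbound (B ∘ fun i => v (a, i))
  have h2 : ‖b.det.toMultilinearMap (B ∘ fun i => v (a, i))‖ =
      |LinearMap.det B| * |b.det (fun i => v (a, i))| := by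
    rw [← abs_mul, ← b.det_comp, Real.norm_eq_abs]
    rfl
  rw [h2] at h1
  have h3 : 0 < |b.det (fun i => v (a, i))| := abs_pos.mpr (hv a)
  rw [mul_assoc, ← div_eq_inv_mul, le_div_iff₀ h3]
  exact h1

/-- After a suitable linear change of coordinates, the normalized vectors of a union of bases
are in approximately isotropic position. -/
lemma exists_isotropic_position [Nonempty κ] (b : Module.Basis ι ℝ V) (v : κ × ι → V)
    (hv : ∀ a, b.det (fun i => v (a, i)) ≠ 0) :
    ∃ B : V →ₗ[ℝ] V, LinearMap.det B ≠ 0 ∧ ∀ e : V, ‖e‖ = 1 →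
      ∑ x, (inner ℝ e (B (v x)) / ‖B (v x)‖) ^ 2 ≤ 8 * Fintype.card κ := by
  set q := Fintype.card κ with hq
  have hq0 : q ≠ 0 := Fintype.card_ne_zero
  have hv0 : ∀ x, v x ≠ 0 := by
    intro x hx
    exact hv x.1 (b.det.map_coord_zero x.2 hx)
  have hinj : ∀ B : V →ₗ[ℝ] V, LinearMap.det B ≠ 0 → ∀ x, 0 < ‖B (v x)‖ := by
    intro B hB x
    rw [norm_pos_iff]
    rw [Ne, map_eq_zero_iff B (LinearMap.equivOfDetNeZero B hB).injective]
    exact hv0 x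
  obtain ⟨K, hK⟩ := exists_abs_det_pow_le b v hv
  let G : (V →ₗ[ℝ] V) → ℝ := fun B => |LinearMap.det B| ^ q / ∏ x, ‖B (v x)‖
  have hGpos : ∀ B : V →ₗ[ℝ] V, LinearMap.det B ≠ 0 → 0 < G B := fun B hB =>
    div_pos (pow_pos (abs_pos.mpr hB) _) (Finset.prod_pos fun x _ => hinj B hB x)
  have hbdd : BddAbove (G '' {B | LinearMap.det B ≠ 0}) := by
    refine ⟨K, ?_⟩
    rintro _ ⟨B, hB, rfl⟩
    exact (div_le_iff₀ (Finset.prod_pos fun x _ => hinj B hB x)).mpr (hK B)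
  have hone : (1 : V →ₗ[ℝ] V) ∈ {B : V →ₗ[ℝ] V | LinearMap.det B ≠ 0} := by simp
  have hsup : 0 < sSup (G '' {B | LinearMap.det B ≠ 0}) :=
    (hGpos 1 hone).trans_le (le_csSup hbdd ⟨1, hone, rfl⟩)
  obtain ⟨_, ⟨B, hB, rfl⟩, hBsup⟩ :=
    exists_lt_of_lt_csSup (Set.Nonempty.image G ⟨1, hone⟩) (half_lt_self hsup)
  refine ⟨B, hB, fun e he => ?_⟩
  by_contra! hcon
  let S : V →ₗ[ℝ] V := LinearMap.transvection (innerSL ℝ e).toLinearMap ((-(1 / 2) : ℝ) • e)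
  have hS : ∀ w, S w = w - ((1 / 2 : ℝ) * inner ℝ e w) • e := by
    intro w
    simp only [S, LinearMap.transvection.apply]
    rw [smul_smul, mul_neg, neg_smul, ← sub_eq_add_neg, mul_comm]
    rfl
  have hSdet : LinearMap.det S = 1 / 2 := by
    simp only [S]
    rw [LinearMap.transvection.det, map_smul]
    have : (innerSL ℝ e).toLinearMap e = 1 := by
      change inner ℝ e e = (1 : ℝ)
      rw [real_inner_self_eq_norm_sq, he, one_pow]
    rw [this]
    norm_num
  have hSB : LinearMap.det (S * B) = 1 / 2 * LinearMap.det B := by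
    rw [map_mul, hSdet]
  have hSB0 : LinearMap.det (S * B) ≠ 0 := by
    rw [hSB]; exact mul_ne_zero (by norm_num) hB
  have hle : G (S * B) ≤ sSup (G '' {B | LinearMap.det B ≠ 0}) := le_csSup hbdd ⟨_, hSB0, rfl⟩
  set c : κ × ι → ℝ := fun x => inner ℝ e (B (v x)) / ‖B (v x)‖ with hc
  have hnorm : ∀ x, ‖(S * B) (v x)‖ ≤ ‖B (v x)‖ * Real.exp (-(3 / 8) * c x ^ 2) := by
    intro x
    have hpos := hinj B hB x
    refine le_of_sq_le_sq ?_ (by positivity)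
    rw [Module.End.mul_apply, hS, norm_sub_half_inner_smul_sq he, mul_pow, ← Real.exp_nat_mul]
    have h1 : inner ℝ e (B (v x)) = c x * ‖B (v x)‖ := by
      simp only [hc]; field_simp
    rw [h1]
    have h2 := Real.add_one_le_exp (((2 : ℕ) : ℝ) * (-(3 / 8) * c x ^ 2))
    calc _ = ‖B (v x)‖ ^ 2 * (((2 : ℕ) : ℝ) * (-(3 / 8) * c x ^ 2) + 1) := by push_cast; ring
      _ ≤ _ := mul_le_mul_of_nonneg_left h2 (by positivity)
  have hprod : ∏ x, ‖(S * B) (v x)‖ ≤ (∏ x, ‖B (v x)‖) * Real.exp (-(3 * q)) := by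
    calc _ ≤ ∏ x, (‖B (v x)‖ * Real.exp (-(3 / 8) * c x ^ 2)) :=
          Finset.prod_le_prod (fun _ _ => norm_nonneg _) fun x _ => hnorm x
      _ = (∏ x, ‖B (v x)‖) * Real.exp (∑ x, -(3 / 8) * c x ^ 2) := by
          rw [Finset.prod_mul_distrib, Real.exp_sum]
      _ ≤ _ := by
          refine mul_le_mul_of_nonneg_left (Real.exp_le_exp.mpr ?_)
            (Finset.prod_nonneg fun _ _ => norm_nonneg _)
          rw [← Finset.mul_sum]
          linarith
  have hexp : (4 : ℝ) ^ q ≤ Real.exp (3 * q) := by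
    rw [mul_comm, Real.exp_nat_mul]
    refine pow_le_pow_left₀ (by norm_num) ?_ q
    have := Real.add_one_le_exp (3 : ℝ)
    linarith
  have hgain : 2 * G B ≤ G (S * B) := by
    have hP : 0 < ∏ x, ‖B (v x)‖ := Finset.prod_pos fun x _ => hinj B hB x
    have hP' : 0 < ∏ x, ‖(S * B) (v x)‖ := Finset.prod_pos fun x _ => hinj _ hSB0 x
    simp only [G]
    rw [mul_div_assoc', div_le_div_iff₀ hP hP', hSB, abs_mul, mul_pow]
    have h2 : (2 : ℝ) ≤ 2 ^ q := by
      calc (2 : ℝ) = 2 ^ 1 := (pow_one 2).symm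
        _ ≤ 2 ^ q := pow_le_pow_right₀ (by norm_num) (Nat.one_le_iff_ne_zero.mpr hq0)
    have h3 : 2 * Real.exp (-(3 * q)) ≤ |1 / 2| ^ q := by
      rw [Real.exp_neg, ← div_eq_mul_inv, div_le_iff₀ (Real.exp_pos _)]
      calc (2 : ℝ) ≤ 2 ^ q := h2
        _ = |1 / 2| ^ q * 4 ^ q := by rw [← mul_pow]; norm_num
        _ ≤ _ := mul_le_mul_of_nonneg_left hexp (by positivity)
    calc 2 * |LinearMap.det B| ^ q * ∏ x, ‖(S * B) (v x)‖
        ≤ 2 * |LinearMap.det B| ^ q * ((∏ x, ‖B (v x)‖) * Real.exp (-(3 * q))) := by gcongr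
      _ = (2 * Real.exp (-(3 * q))) * (|LinearMap.det B| ^ q * ∏ x, ‖B (v x)‖) := by ring
      _ ≤ |1 / 2| ^ q * (|LinearMap.det B| ^ q * ∏ x, ‖B (v x)‖) := by gcongr
      _ = _ := by ring
  linarith

end IsotropicPosition

section SignSplitting

open MeasureTheory ProbabilityTheory Filter Topology

lemma exists_unit_sign_split_of_det_ne_zero {V ι κ : Type*} [NormedAddCommGroup V]
    [InnerProductSpace ℝ V] [FiniteDimensional ℝ V] [Fintype ι] [DecidableEq ι] [Nonempty ι]
    [Fintype κ] [Nonempty κ] (b : Module.Basis ι ℝ V) (v : κ × ι → V)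
    (hv : ∀ a, b.det (fun i => v (a, i)) ≠ 0) (R : Finset ((κ × ι) × (κ × ι))) :
    ∃ l : V, ‖l‖ = 1 ∧ ((R.filter fun p => 0 < inner ℝ l (v p.1) * inner ℝ l (v p.2)).card : ℝ) ≤
      R.card / 2 + 12 * Fintype.card κ * √(R.card * Fintype.card ι) := by
  let : MeasurableSpace V := borel V
  have : BorelSpace V := ⟨rfl⟩
  obtain ⟨B, hB, hiso⟩ := exists_isotropic_position b v hv
  have hv0 : ∀ x, v x ≠ 0 := fun x hx => hv x.1 (b.det.map_coord_zero x.2 hx)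
  have hpos : ∀ x, 0 < ‖B (v x)‖ := by
    intro x
    rw [norm_pos_iff, Ne, map_eq_zero_iff B (LinearMap.equivOfDetNeZero B hB).injective]
    exact hv0 x
  set u : κ × ι → V := fun x => ‖B (v x)‖⁻¹ • B (v x) with hu
  have hu1 : ∀ x, ‖u x‖ = 1 := fun x => by
    rw [hu, norm_smul, norm_inv, norm_norm, inv_mul_cancel₀ (hpos x).ne']
  let A : (κ × ι) × (κ × ι) → Set V := fun p => {g | 0 < inner ℝ (u p.1) g * inner ℝ (u p.2) g}
  have hA : ∀ p, MeasurableSet (A p) := fun p => measurableSet_lt (by fun_prop) (by fun_prop)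
  let f : V → ℝ := fun g => ∑ p ∈ R, (A p).indicator 1 g
  have hint : ∀ p ∈ R, Integrable ((A p).indicator (1 : V → ℝ)) (stdGaussian V) := fun p _ =>
    (integrable_const (1 : ℝ)).indicator (hA p)
  have hf : Integrable f (stdGaussian V) := integrable_finsetSum R hint
  obtain ⟨x₀⟩ : Nonempty (κ × ι) := inferInstance
  have hnull : stdGaussian V {g | inner ℝ (u x₀) g = 0} = 0 := by
    have h1 : {g : V | inner ℝ (u x₀) g = 0} = (fun g : V => (inner ℝ (u x₀) g : ℝ)) ⁻¹' {0} := rfl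
    have : NullSingletonClass (gaussianReal 0 1) :=
      nullSingletonClass_gaussianReal one_ne_zero
    rw [h1, ← Measure.map_apply (by fun_prop) (measurableSet_singleton 0),
      stdGaussian_map_inner (hu1 x₀), measure_singleton]
  obtain ⟨g, hg0, hg⟩ := exists_notMem_null_le_integral hf hnull
  rw [integral_finsetSum R hint] at hg
  simp_rw [integral_indicator_one (hA _)] at hg
  have hsum : ∑ p ∈ R, (stdGaussian V).real (A p) ≤
      ∑ p ∈ R, (1 / 2 + 4 * |inner ℝ (u p.1) (u p.2)|) :=
    Finset.sum_le_sum fun p _ => stdGaussian_same_side_le (hu1 p.1) (hu1 p.2)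
  have hsq : ∑ p ∈ R, |inner ℝ (u p.1) (u p.2)| ^ 2 ≤
      8 * (Fintype.card κ : ℝ) ^ 2 * Fintype.card ι := by
    calc ∑ p ∈ R, |inner ℝ (u p.1) (u p.2)| ^ 2
        ≤ ∑ p : (κ × ι) × (κ × ι), |inner ℝ (u p.1) (u p.2)| ^ 2 :=
          Finset.sum_le_sum_of_subset_of_nonneg (Finset.subset_univ R) fun _ _ _ => sq_nonneg _
      _ = ∑ y : κ × ι, ∑ x : κ × ι, (inner ℝ (u y) (B (v x)) / ‖B (v x)‖) ^ 2 := by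
          rw [Fintype.sum_prod_type]
          refine Finset.sum_congr rfl fun y _ => Finset.sum_congr rfl fun x _ => ?_
          rw [sq_abs, show u x = ‖B (v x)‖⁻¹ • B (v x) from rfl, inner_smul_right, div_eq_inv_mul]
      _ ≤ ∑ y : κ × ι, 8 * (Fintype.card κ : ℝ) :=
          Finset.sum_le_sum fun y _ => hiso (u y) (hu1 y)
      _ = _ := by
          rw [Finset.sum_const, Finset.card_univ, Fintype.card_prod, nsmul_eq_mul]
          push_cast
          ring
  have hcs : ∑ p ∈ R, |inner ℝ (u p.1) (u p.2)| ≤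
      3 * Fintype.card κ * √(R.card * Fintype.card ι) := by
    refine le_of_sq_le_sq ?_ (by positivity)
    rw [mul_pow, Real.sq_sqrt (by positivity)]
    calc _ ≤ (R.card : ℝ) * ∑ p ∈ R, |inner ℝ (u p.1) (u p.2)| ^ 2 := sq_sum_le_card_mul_sum_sq
      _ ≤ R.card * (8 * (Fintype.card κ : ℝ) ^ 2 * Fintype.card ι) := by gcongr
      _ ≤ _ := by
        have : 0 ≤ (R.card : ℝ) * ((Fintype.card κ : ℝ) ^ 2 * Fintype.card ι) := by positivity
        linarith
  let l : V := LinearMap.adjoint B g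
  have hl : ∀ x, inner ℝ l (v x) = ‖B (v x)‖ * inner ℝ (u x) g := by
    intro x
    simp only [l, hu]
    rw [LinearMap.adjoint_inner_left, inner_smul_left, real_inner_comm]
    simp only [conj_trivial]
    rw [mul_inv_cancel_left₀ (hpos x).ne']
  have hl0 : l ≠ 0 := by
    intro h
    have h1 := hl x₀
    rw [h, inner_zero_left] at h1
    exact hg0 ((mul_eq_zero.mp h1.symm).resolve_left (hpos x₀).ne')
  have hl1 : ‖‖l‖⁻¹ • l‖ = 1 := by
    rw [norm_smul, norm_inv, norm_norm, inv_mul_cancel₀ (norm_ne_zero_iff.mpr hl0)]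
  refine ⟨‖l‖⁻¹ • l, hl1, ?_⟩
  have hcard : ((R.filter fun p => 0 < inner ℝ (‖l‖⁻¹ • l) (v p.1) *
      inner ℝ (‖l‖⁻¹ • l) (v p.2)).card : ℝ) ≤ f g := by
    rw [Finset.card_filter]
    push_cast
    refine Finset.sum_le_sum fun p _ => ?_
    split_ifs with h
    · have hmem : g ∈ A p := by
        change 0 < inner ℝ (u p.1) g * inner ℝ (u p.2) g
        rw [inner_smul_left, inner_smul_left, hl, hl] at h
        simp only [conj_trivial] at h
        have hln : 0 < ‖l‖ := norm_pos_iff.mpr hl0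
        have h1 := hpos p.1
        have h2 := hpos p.2
        have h3 : 0 < (‖l‖⁻¹ * ‖l‖⁻¹ * ‖B (v p.1)‖ * ‖B (v p.2)‖) *
            (inner ℝ (u p.1) g * inner ℝ (u p.2) g) := by
          convert h using 1; ring
        exact (pos_iff_pos_of_mul_pos h3).mp (by positivity)
      rw [Set.indicator_of_mem hmem]
      rfl
    · exact Set.indicator_nonneg (fun _ _ => zero_le_one) _
  calc _ ≤ ∑ p ∈ R, (1 / 2 + 4 * |inner ℝ (u p.1) (u p.2)|) := hcard.trans (hg.trans hsum)
    _ = R.card / 2 + 4 * ∑ p ∈ R, |inner ℝ (u p.1) (u p.2)| := by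
        rw [Finset.sum_add_distrib, Finset.sum_const, nsmul_eq_mul, Finset.mul_sum]; ring
    _ ≤ _ := by linarith

lemma eventually_det_add_smul_basis_ne_zero {V ι : Type*} [AddCommGroup V] [Module ℝ V] [Fintype ι]
    [DecidableEq ι] (b : Module.Basis ι ℝ V) (v : ι → V) :
    ∀ᶠ ε : ℝ in 𝓝[≠] 0, b.det (fun i => v i + ε • b i) ≠ 0 := by
  have heval : ∀ ε : ℝ, b.det (fun i => v i + ε • b i) = (-b.toMatrix v).charpoly.eval ε := by
    intro ε
    rw [Matrix.eval_charpoly, b.det_apply]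
    congr 1
    ext i j
    simp [Module.Basis.toMatrix_apply, Matrix.scalar_apply, Matrix.diagonal_apply,
      Finsupp.single_apply, eq_comm, add_comm]
  have hfin : ((-b.toMatrix v).charpoly.rootSet ℝ).Finite := Polynomial.rootSet_finite _ _
  refine nhdsNE_le_cofinite 0 (hfin.eventually_cofinite_notMem.mono fun ε hε h => hε ?_)
  rw [Polynomial.mem_rootSet_of_ne (Matrix.charpoly_monic _).ne_zero, Polynomial.coe_aeval_eq_eval,
    ← heval, h]

lemma exists_unit_sign_split {V ι κ : Type*} [NormedAddCommGroup V]
    [InnerProductSpace ℝ V] [FiniteDimensional ℝ V] [Fintype ι] [DecidableEq ι] [Nonempty ι]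
    [Fintype κ] [Nonempty κ] (b : Module.Basis ι ℝ V) (v : κ × ι → V)
    (R : Finset ((κ × ι) × (κ × ι))) :
    ∃ l : V, ‖l‖ = 1 ∧ ((R.filter fun p => 0 < inner ℝ l (v p.1) * inner ℝ l (v p.2)).card : ℝ) ≤
      R.card / 2 + 12 * Fintype.card κ * √(R.card * Fintype.card ι) := by
  have hev : ∀ᶠ ε : ℝ in 𝓝[≠] 0, ∀ a, b.det (fun i => v (a, i) + ε • b i) ≠ 0 :=
    eventually_all.mpr fun a => eventually_det_add_smul_basis_ne_zero b fun i => v (a, i)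
  obtain ⟨ε, hε, hdet⟩ := exists_seq_forall_of_frequently hev.frequently
  have hε0 : Tendsto ε atTop (𝓝 0) := hε.mono_right nhdsWithin_le_nhds
  let w : ℕ → κ × ι → V := fun k x => v x + ε k • b x.2
  choose l hl hcard using fun k => exists_unit_sign_split_of_det_ne_zero b (w k) (hdet k) R
  obtain ⟨l₀, hl₀, φ, hφ, hlim⟩ := (isCompact_sphere (0 : V) 1).tendsto_subseq
    (x := l) fun k => mem_sphere_zero_iff_norm.mpr (hl k)
  refine ⟨l₀, mem_sphere_zero_iff_norm.mp hl₀, ?_⟩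
  have hinner : ∀ x, Tendsto (fun k => (inner ℝ (l (φ k)) (w (φ k) x) : ℝ)) atTop
      (𝓝 (inner ℝ l₀ (v x))) := by
    intro x
    refine Tendsto.inner hlim ?_
    have h1 : Tendsto (fun k => v x + ε (φ k) • b x.2) atTop (𝓝 (v x + (0 : ℝ) • b x.2)) :=
      tendsto_const_nhds.add ((hε0.comp hφ.tendsto_atTop).smul_const _)
    simpa using h1
  have hsign : ∀ᶠ k in atTop, ∀ p ∈ R, 0 < inner ℝ l₀ (v p.1) * inner ℝ l₀ (v p.2) →
      0 < inner ℝ (l (φ k)) (w (φ k) p.1) * inner ℝ (l (φ k)) (w (φ k) p.2) := by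
    rw [Filter.eventually_all_finset]
    intro p _
    by_cases h : 0 < inner ℝ l₀ (v p.1) * inner ℝ l₀ (v p.2)
    · filter_upwards [((hinner p.1).mul (hinner p.2)).eventually_const_lt h] with k hk _ using hk
    · exact Eventually.of_forall fun _ h' => absurd h' h
  obtain ⟨k, hk⟩ := hsign.exists
  refine le_trans ?_ (hcard (φ k))
  exact_mod_cast Finset.card_le_card fun p hp => by
    rw [Finset.mem_filter] at hp ⊢
    exact ⟨hp.1, hk p hp.1 hp.2⟩

/-- Approximate simultaneous bisection: some hyperplane through the origin separates almost half of
any prescribed set of pairs of points, provided the dimension of the space is large. -/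
lemma exists_ne_zero_sign_split {ι α : Type*} [Fintype ι] [Nonempty ι] [Fintype α]
    (φ : α → EuclideanSpace ℝ ι) (R : Finset (α × α)) :
    ∃ l : EuclideanSpace ℝ ι, l ≠ 0 ∧
      ((R.filter fun p => 0 < inner ℝ l (φ p.1) * inner ℝ l (φ p.2)).card : ℝ) ≤
        R.card / 2 + 24 * Fintype.card α * √(R.card / Fintype.card ι) := by
  classical
  have hN : 0 < Fintype.card ι := Fintype.card_pos
  rcases lt_or_ge (Fintype.card α) (Fintype.card ι) with hlt | hge
  · have hrank : Module.finrank ℝ (Submodule.span ℝ (Set.range φ)) <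
        Module.finrank ℝ (EuclideanSpace ℝ ι) := by
      rw [finrank_euclideanSpace]
      exact (finrank_range_le_card φ).trans_lt hlt
    have hne : (Submodule.span ℝ (Set.range φ))ᗮ ≠ ⊥ := by
      rw [Ne, Submodule.orthogonal_eq_bot_iff]
      intro h
      rw [h, finrank_top] at hrank
      exact lt_irrefl _ hrank
    obtain ⟨l, hl, hl0⟩ := Submodule.exists_mem_ne_zero_of_ne_bot hne
    refine ⟨l, hl0, ?_⟩
    have hempty : (R.filter fun p => 0 < inner ℝ l (φ p.1) * inner ℝ l (φ p.2)) = ∅ := by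
      refine Finset.filter_false_of_mem fun p _ => ?_
      rw [(Submodule.mem_orthogonal' _ _).mp hl _ (Submodule.subset_span ⟨p.1, rfl⟩), zero_mul]
      exact lt_irrefl 0
    rw [hempty, Finset.card_empty, Nat.cast_zero]
    positivity
  · set q := Fintype.card α / Fintype.card ι + 1 with hq
    have hcard : Fintype.card α ≤ Fintype.card (Fin q × ι) := by
      rw [Fintype.card_prod, Fintype.card_fin, hq]
      have := Nat.lt_div_mul_add hN (a := Fintype.card α)
      linarith
    obtain ⟨f⟩ := Function.Embedding.nonempty_of_card_le hcard
    obtain ⟨l, hl, hsplit⟩ := exists_unit_sign_split (EuclideanSpace.basisFun ι ℝ).toBasis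
      (Function.extend f φ 0) (R.map (f.prodMap f))
    refine ⟨l, fun h => by simp [h] at hl, ?_⟩
    have hext : ∀ x, Function.extend f φ 0 (f x) = φ x := fun x => f.injective.extend_apply φ 0 x
    rw [Finset.filter_map, Finset.card_map, Finset.card_map, Fintype.card_fin] at hsplit
    simp only [Function.comp_def, Function.Embedding.coe_prodMap, Prod.map_fst, Prod.map_snd,
      hext] at hsplit
    refine hsplit.trans (add_le_add_right ?_ _)
    have hNr : (0 : ℝ) < Fintype.card ι := Nat.cast_pos.mpr hN
    have hqle : (q : ℝ) ≤ 2 * Fintype.card α / Fintype.card ι := by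
      have h1 : ((Fintype.card α / Fintype.card ι : ℕ) : ℝ) ≤ Fintype.card α / Fintype.card ι :=
        Nat.cast_div_le
      have h2 : (1 : ℝ) ≤ Fintype.card α / Fintype.card ι := by
        rw [one_le_div hNr]; exact_mod_cast hge
      rw [hq, mul_div_assoc]
      push_cast
      linarith
    have hsqrt : √(R.card * Fintype.card ι : ℝ) = Fintype.card ι * √(R.card / Fintype.card ι) := by
      rw [← Real.sqrt_sq hNr.le, ← Real.sqrt_mul (sq_nonneg _), Real.sqrt_sq hNr.le]
      congr 1
      field_simp
    rw [hsqrt]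
    calc 12 * (q : ℝ) * (Fintype.card ι * √(R.card / Fintype.card ι))
        ≤ 12 * (2 * Fintype.card α / Fintype.card ι) *
            (Fintype.card ι * √(R.card / Fintype.card ι)) := by gcongr
      _ = _ := by field_simp; ring

end SignSplitting

section PolynomialCells

open MvPolynomial

variable {n : ℕ}

/-- The polynomial with prescribed coefficients, all exponents being less than `k`. -/
noncomputable def boxPolynomial {k : ℕ} (c : (Fin n → Fin k) → ℝ) : MvPolynomial (Fin n) ℝ :=
  ∑ a, monomial (Finsupp.equivFunOnFinite.symm fun i => (a i : ℕ)) (c a)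

lemma coeff_boxPolynomial {k : ℕ} (c : (Fin n → Fin k) → ℝ) (a : Fin n → Fin k) :
    (boxPolynomial c).coeff (Finsupp.equivFunOnFinite.symm fun i => (a i : ℕ)) = c a := by
  classical
  rw [boxPolynomial, coeff_sum, Finset.sum_eq_single a]
  · rw [coeff_monomial, if_pos rfl]
  · intro a' _ hne
    rw [coeff_monomial, if_neg]
    intro h
    refine hne (funext fun i => Fin.ext ?_)
    exact congrFun (Finsupp.equivFunOnFinite.symm.injective h) i
  · exact fun h => absurd (Finset.mem_univ a) h

lemma totalDegree_boxPolynomial_le {k : ℕ} (c : (Fin n → Fin k) → ℝ) :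
    (boxPolynomial c).totalDegree ≤ n * k := by
  refine totalDegree_finsetSum_le fun a _ => (totalDegree_monomial_le _ _).trans ?_
  rw [Finsupp.sum_fintype _ _ fun _ => rfl]
  calc ∑ i, (a i : ℕ) ≤ ∑ _i : Fin n, k := Finset.sum_le_sum fun i _ => (a i).isLt.le
    _ = n * k := by simp

lemma eval_boxPolynomial {k : ℕ} (c : (Fin n → Fin k) → ℝ) (x : Fin n → ℝ) :
    eval x (boxPolynomial c) = ∑ a, c a * ∏ i, x i ^ (a i : ℕ) := by
  rw [boxPolynomial, map_sum]
  refine Finset.sum_congr rfl fun a _ => ?_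
  rw [eval_monomial, Finsupp.prod_fintype _ _ fun _ => pow_zero _]
  rfl

lemma exists_polynomial_sign_split {α : Type*} [Fintype α] (pt : α → Fin n → ℝ)
    (R : Finset (α × α)) {k : ℕ} (hk : 0 < k) :
    ∃ f : MvPolynomial (Fin n) ℝ, f ≠ 0 ∧ f.totalDegree ≤ n * k ∧
      ((R.filter fun p => 0 < eval (pt p.1) f * eval (pt p.2) f).card : ℝ) ≤
        R.card / 2 + 24 * Fintype.card α * √(R.card / (k : ℝ) ^ n) := by
  have : Nonempty (Fin k) := ⟨⟨0, hk⟩⟩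
  obtain ⟨l, hl, hsplit⟩ := exists_ne_zero_sign_split
    (fun x => WithLp.toLp 2 fun a : Fin n → Fin k => ∏ i, pt x i ^ (a i : ℕ)) R
  have heval : ∀ x, inner ℝ l (WithLp.toLp 2 fun a : Fin n → Fin k => ∏ i, pt x i ^ (a i : ℕ)) =
      eval (pt x) (boxPolynomial l) := by
    intro x
    rw [eval_boxPolynomial, PiLp.inner_apply]
    exact Finset.sum_congr rfl fun a _ => by simp [mul_comm]
  refine ⟨boxPolynomial l, ?_, totalDegree_boxPolynomial_le _, ?_⟩
  · intro h
    refine hl (PiLp.ext fun a => ?_)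
    rw [← coeff_boxPolynomial l a, h, coeff_zero]
    rfl
  · simp_rw [heval] at hsplit
    simpa using hsplit

/-- The cell of the partition determined by `Q` that contains `x`. -/
def cell (Q : MvPolynomial (Fin n) ℝ) (x : EuclideanSpace ℝ (Fin n)) :
    Set (EuclideanSpace ℝ (Fin n)) :=
  connectedComponentIn {y : EuclideanSpace ℝ (Fin n) | eval (fun i => y i) Q ≠ 0} x

lemma cell_mul_subset_left (Q f : MvPolynomial (Fin n) ℝ) (x : EuclideanSpace ℝ (Fin n)) :
    cell (Q * f) x ⊆ cell Q x :=
  connectedComponentIn_mono x fun y (hy : eval (fun i => y i) (Q * f) ≠ 0) => by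
    rw [map_mul] at hy
    exact left_ne_zero_of_mul hy

lemma cell_mul_subset_right (Q f : MvPolynomial (Fin n) ℝ) (x : EuclideanSpace ℝ (Fin n)) :
    cell (Q * f) x ⊆ cell f x := mul_comm Q f ▸ cell_mul_subset_left f Q x

lemma cell_eq {Q : MvPolynomial (Fin n) ℝ} {x y : EuclideanSpace ℝ (Fin n)} (h : y ∈ cell Q x) :
    cell Q x = cell Q y :=
  connectedComponentIn_eq h

lemma mem_cell_comm {Q : MvPolynomial (Fin n) ℝ} {x y : EuclideanSpace ℝ (Fin n)}
    (h : y ∈ cell Q x) : x ∈ cell Q y := by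
  rw [← cell_eq h]
  by_contra hx
  rw [cell, connectedComponentIn_eq_empty fun hx' => hx (mem_connectedComponentIn hx')] at h
  exact h

lemma eval_mul_eval_pos_of_mem_cell {Q : MvPolynomial (Fin n) ℝ} {x y : EuclideanSpace ℝ (Fin n)}
    (h : y ∈ cell Q x) : 0 < eval (fun i => x i) Q * eval (fun i => y i) Q := by
  have hx : x ∈ cell Q x := cell_eq h ▸ mem_cell_comm h
  have hcont : Continuous fun z : EuclideanSpace ℝ (Fin n) => eval (fun i => z i) Q :=
    (MvPolynomial.continuous_eval Q).comp (by fun_prop)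
  have hconn : IsPreconnected ((fun z : EuclideanSpace ℝ (Fin n) => eval (fun i => z i) Q) ''
      cell Q x) := isPreconnected_connectedComponentIn.image _ hcont.continuousOn
  by_contra! hneg
  have hmem : (0 : ℝ) ∈ Set.uIcc (eval (fun i => x i) Q) (eval (fun i => y i) Q) := by
    rw [Set.mem_uIcc]
    rcases mul_nonpos_iff.mp hneg with h' | h'
    · exact Or.inr ⟨h'.2, h'.1⟩
    · exact Or.inl h'
  obtain ⟨z, hz, hz0⟩ := hconn.ordConnected.uIcc_subset ⟨x, hx, rfl⟩ ⟨y, h, rfl⟩ hmem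
  exact connectedComponentIn_subset _ _ hz hz0

/-- Iterated approximate bisection with boxes of exponents of sizes `k 0, k 1, …`. -/
lemma exists_iterated_split {α : Type*} [Fintype α] (pt : α → EuclideanSpace ℝ (Fin n))
    {k : ℕ → ℕ} (hk : ∀ i, 0 < k i) (j : ℕ) :
    ∃ (Q : MvPolynomial (Fin n) ℝ) (R : Finset (α × α)), Q ≠ 0 ∧
      Q.totalDegree ≤ n * ∑ i ∈ Finset.range j, k i ∧
      (∀ x y, pt y ∈ cell Q (pt x) → (x, y) ∈ R) ∧
      (2 : ℝ) ^ j * R.card ≤ (Fintype.card α *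
        (1 + 24 * ∑ i ∈ Finset.range j, √((2 : ℝ) ^ i / (k i : ℝ) ^ n))) ^ 2 := by
  induction j with
  | zero =>
    refine ⟨1, Finset.univ, one_ne_zero, by simp, fun _ _ _ => Finset.mem_univ _, ?_⟩
    simp [sq]
  | succ j ih =>
    obtain ⟨Q, R, hQ, hdeg, hR, hcard⟩ := ih
    obtain ⟨f, hf, hfdeg, hsplit⟩ := exists_polynomial_sign_split (fun x i => pt x i) R (hk j)
    refine ⟨Q * f, R.filter fun p => 0 < eval (fun i => pt p.1 i) f * eval (fun i => pt p.2 i) f,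
      mul_ne_zero hQ hf, ?_, ?_, ?_⟩
    · rw [Finset.sum_range_succ, mul_add]
      exact (totalDegree_mul _ _).trans (add_le_add hdeg hfdeg)
    · intro x y hxy
      rw [Finset.mem_filter]
      exact ⟨hR x y (cell_mul_subset_left _ _ _ hxy),
        eval_mul_eval_pos_of_mem_cell (cell_mul_subset_right _ _ _ hxy)⟩
    · rw [Finset.sum_range_succ]
      set S := ∑ i ∈ Finset.range j, √((2 : ℝ) ^ i / (k i : ℝ) ^ n)
      have hS : 0 ≤ S := Finset.sum_nonneg fun _ _ => Real.sqrt_nonneg _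
      set r := √((2 : ℝ) ^ j / (k j : ℝ) ^ n)
      set s := √((2 : ℝ) ^ j * R.card)
      have hs : s ≤ Fintype.card α * (1 + 24 * S) := Real.sqrt_le_iff.mpr ⟨by positivity, hcard⟩
      have hs2 : s ^ 2 = (2 : ℝ) ^ j * R.card := Real.sq_sqrt (by positivity)
      have hrs : (2 : ℝ) ^ j * √(R.card / (k j : ℝ) ^ n) = s * r := by
        rw [← Real.sqrt_mul (by positivity)]
        conv_lhs => rw [← Real.sqrt_sq (show (0 : ℝ) ≤ 2 ^ j by positivity)]
        rw [← Real.sqrt_mul (by positivity)]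
        congr 1
        ring
      have hr : 0 ≤ r := Real.sqrt_nonneg _
      calc _ ≤ (2 : ℝ) ^ (j + 1) * (R.card / 2 + 24 * Fintype.card α *
            √(R.card / (k j : ℝ) ^ n)) := mul_le_mul_of_nonneg_left hsplit (by positivity)
        _ = s ^ 2 + 48 * Fintype.card α * (s * r) := by rw [hs2, ← hrs]; ring
        _ ≤ (s + 24 * Fintype.card α * r) ^ 2 := by
            nlinarith [sq_nonneg (24 * Fintype.card α * r)]
        _ ≤ (Fintype.card α * (1 + 24 * S) + 24 * Fintype.card α * r) ^ 2 := by gcongr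
        _ = _ := by ring

lemma sum_range_mul_div {M : Type*} [AddCommMonoid M] (g : ℕ → M) {m : ℕ} (hm : 0 < m) (L : ℕ) :
    ∑ j ∈ Finset.range (m * L), g (j / m) = m • ∑ i ∈ Finset.range L, g i := by
  induction L with
  | zero => simp
  | succ L ih =>
    rw [mul_add, mul_one, Finset.sum_range_add, ih, Finset.sum_range_succ, smul_add]
    congr 1
    rw [Finset.sum_congr rfl (g := fun _ => g L), Finset.sum_const, Finset.card_range]
    intro x hx
    rw [Nat.mul_add_div hm, Nat.div_eq_of_lt (Finset.mem_range.mp hx), add_zero]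

lemma sum_range_two_pow_add_le (L : ℕ) : ∑ i ∈ Finset.range L, 2 ^ (i + L) ≤ 4 ^ L := by
  simp_rw [pow_add]
  rw [← Finset.sum_mul, show 4 = 2 * 2 from rfl, mul_pow]
  gcongr
  rw [Nat.geomSum_eq le_rfl]
  simp

lemma sum_range_sqrt_ratio_le (hn : 1 ≤ n) (L : ℕ) :
    ∑ j ∈ Finset.range (2 * n * L), √((2 : ℝ) ^ j / ((2 ^ (j / (2 * n) + L) : ℕ) : ℝ) ^ n) ≤
      6 * n * 2 ^ n := by
  have hterm : ∀ j ∈ Finset.range (2 * n * L),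
      √((2 : ℝ) ^ j / ((2 ^ (j / (2 * n) + L) : ℕ) : ℝ) ^ n) ≤
        2 ^ n * (3 / 4 : ℝ) ^ (L - j / (2 * n)) := by
    intro j hj
    set i := j / (2 * n) with hi
    have hiL : i < L := Nat.div_lt_of_lt_mul (Finset.mem_range.mp hj)
    have hji : j ≤ 2 * n * (i + 1) := (Nat.lt_mul_div_succ j (by omega)).le
    obtain ⟨r, rfl⟩ := Nat.exists_eq_add_of_lt hiL
    rw [Real.sqrt_le_iff]
    refine ⟨by positivity, ?_⟩
    rw [div_le_iff₀ (by positivity), show i + r + 1 - i = r + 1 by omega]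
    have h1 : (1 : ℝ) ≤ ((3 / 4 : ℝ) ^ (r + 1)) ^ 2 * (2 ^ (r + 1)) ^ n := by
      calc (1 : ℝ) ≤ (9 / 8) ^ (r + 1) := one_le_pow₀ (by norm_num)
        _ = ((3 / 4 : ℝ) ^ (r + 1)) ^ 2 * (2 ^ (r + 1)) ^ 1 := by
            rw [← pow_mul, mul_comm (r + 1) 2, pow_mul, pow_one, ← mul_pow]; norm_num
        _ ≤ _ := by
            gcongr
            exact one_le_pow₀ (by norm_num)
    calc (2 : ℝ) ^ j ≤ 2 ^ (2 * n * (i + 1)) := pow_le_pow_right₀ (by norm_num) hji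
      _ = 2 ^ (2 * n * (i + 1)) * 1 := (mul_one _).symm
      _ ≤ 2 ^ (2 * n * (i + 1)) * (((3 / 4 : ℝ) ^ (r + 1)) ^ 2 * (2 ^ (r + 1)) ^ n) := by gcongr
      _ = _ := by push_cast; ring
  refine (Finset.sum_le_sum hterm).trans ?_
  rw [sum_range_mul_div (fun i => (2 : ℝ) ^ n * (3 / 4 : ℝ) ^ (L - i)) (by omega)]
  have hgeom : ∀ L : ℕ, ∑ i ∈ Finset.range L, (3 / 4 : ℝ) ^ (L - i) ≤ 3 := by
    intro L
    induction L with
    | zero => simp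
    | succ L ih =>
      rw [Finset.sum_range_succ]
      have : ∑ i ∈ Finset.range L, (3 / 4 : ℝ) ^ (L + 1 - i) =
          3 / 4 * ∑ i ∈ Finset.range L, (3 / 4 : ℝ) ^ (L - i) := by
        rw [Finset.mul_sum]
        refine Finset.sum_congr rfl fun i hi => ?_
        rw [Nat.succ_sub (Finset.mem_range.mp hi).le, pow_succ']
      rw [this, Nat.add_sub_cancel_left, pow_one]
      linarith
  rw [← Finset.mul_sum, nsmul_eq_mul]
  push_cast
  calc (2 : ℝ) * n * (2 ^ n * ∑ i ∈ Finset.range L, (3 / 4 : ℝ) ^ (L - i))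
      ≤ 2 * n * (2 ^ n * 3) := by gcongr; exact hgeom L
    _ = _ := by ring

open Classical in
/-- Polynomial partitioning in the mean square sense. -/
lemma exists_sum_card_cell_le (hn : 1 ≤ n) :
    ∃ C : ℝ, 0 < C ∧ ∀ (P : Finset (EuclideanSpace ℝ (Fin n))) (D : ℕ), 0 < D →
      ∃ Q : MvPolynomial (Fin n) ℝ, Q ≠ 0 ∧ Q.totalDegree ≤ D ∧
        ∑ x ∈ P, ((P.filter (· ∈ cell Q x)).card : ℝ) ≤ C * (P.card : ℝ) ^ 2 / (D : ℝ) ^ n := by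
  set M : ℕ := 2 * n ^ 2 with hM
  have hM0 : 0 < M := by positivity
  set T : ℝ := 1 + 24 * (6 * n * 2 ^ n) with hT
  have hT1 : 1 ≤ T := by
    have : (0 : ℝ) ≤ 24 * (6 * n * 2 ^ n) := by positivity
    linarith
  refine ⟨(4 * M) ^ n * T ^ 2, by positivity, fun P D hD => ?_⟩
  have hDr : (0 : ℝ) < (D : ℝ) ^ n := by positivity
  rcases lt_or_ge D M with hlt | hge
  · refine ⟨1, one_ne_zero, by simp, ?_⟩
    have h1 : ∑ x ∈ P, ((P.filter (· ∈ cell 1 x)).card : ℝ) ≤ (P.card : ℝ) ^ 2 := by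
      calc _ ≤ ∑ _x ∈ P, (P.card : ℝ) :=
            Finset.sum_le_sum fun x _ => Nat.cast_le.mpr (Finset.card_filter_le _ _)
        _ = _ := by rw [Finset.sum_const, nsmul_eq_mul, sq]
    have h2 : (D : ℝ) ^ n ≤ (4 * M) ^ n * T ^ 2 := by
      have h3 : (D : ℝ) ≤ 4 * M := by
        have : (D : ℝ) < M := by exact_mod_cast hlt
        have : (0 : ℝ) < M := by exact_mod_cast hM0
        linarith
      calc (D : ℝ) ^ n ≤ (4 * M) ^ n := by gcongr
        _ = (4 * M) ^ n * 1 := (mul_one _).symm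
        _ ≤ _ := by
            gcongr
            exact one_le_pow₀ hT1
    rw [le_div_iff₀ hDr]
    calc _ ≤ (P.card : ℝ) ^ 2 * ((4 * M) ^ n * T ^ 2) := mul_le_mul h1 h2 hDr.le (sq_nonneg _)
      _ = _ := by ring
  · set L := Nat.log 4 (D / M) with hL
    have hDM : D / M ≠ 0 := (Nat.div_pos hge hM0).ne'
    have hLlow : M * 4 ^ L ≤ D := by
      have := Nat.pow_log_le_self 4 hDM
      calc M * 4 ^ L ≤ M * (D / M) := Nat.mul_le_mul_left _ this
        _ ≤ D := Nat.mul_div_le D M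
    have hLup : D ≤ 4 * M * 4 ^ L := by
      have h1 : D / M < 4 ^ (L + 1) := Nat.lt_pow_succ_log_self (by norm_num) _
      have h2 := (Nat.div_lt_iff_lt_mul hM0).mp h1
      rw [pow_succ] at h2
      linarith
    obtain ⟨Q, R, hQ, hdeg, hR, hcard⟩ := exists_iterated_split
      (fun x : P => (x : EuclideanSpace ℝ (Fin n)))
      (k := fun j => 2 ^ (j / (2 * n) + L)) (fun i => by positivity) (2 * n * L)
    refine ⟨Q, hQ, ?_, ?_⟩
    · refine hdeg.trans (le_trans ?_ hLlow)
      rw [sum_range_mul_div (fun i => 2 ^ (i + L)) (by omega), smul_eq_mul, hM]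
      calc n * (2 * n * ∑ i ∈ Finset.range L, 2 ^ (i + L)) ≤ n * (2 * n * 4 ^ L) := by
            gcongr
            exact sum_range_two_pow_add_le L
        _ = _ := by ring
    · have hsum : ∑ x ∈ P, ((P.filter (· ∈ cell Q x)).card : ℝ) ≤ R.card := by
        have h1 : Finset.univ.filter (fun p : P × P => (p.2 : EuclideanSpace ℝ (Fin n)) ∈ cell Q p.1)
            ⊆ R := fun p hp => hR p.1 p.2 (Finset.mem_filter.mp hp).2
        have h2 := Finset.card_le_card h1
        rw [Finset.card_filter, Fintype.sum_prod_type] at h2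
        have h3 : ∑ x ∈ P, (P.filter (· ∈ cell Q x)).card ≤ R.card := by
          refine le_trans (le_of_eq ?_) h2
          rw [← Finset.sum_coe_sort]
          refine Finset.sum_congr rfl fun x _ => ?_
          rw [Finset.card_filter, ← Finset.sum_coe_sort]
        exact_mod_cast h3
      have h4 : (Fintype.card P * (1 + 24 * ∑ i ∈ Finset.range (2 * n * L),
          √((2 : ℝ) ^ i / ((2 ^ (i / (2 * n) + L) : ℕ) : ℝ) ^ n))) ^ 2 ≤ ((P.card : ℝ) * T) ^ 2 := by
        rw [Fintype.card_coe, hT]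
        gcongr
        exact sum_range_sqrt_ratio_le hn L
      have h5 : (D : ℝ) ^ n ≤ (4 * M) ^ n * 2 ^ (2 * n * L) := by
        calc (D : ℝ) ^ n ≤ (4 * M * 4 ^ L) ^ n := by
              gcongr
              exact_mod_cast hLup
          _ = _ := by
              rw [mul_pow, show (4 : ℝ) = 2 ^ 2 by norm_num, ← pow_mul, ← pow_mul]
              congr 2
              ring
      rw [le_div_iff₀ hDr]
      calc _ ≤ (R.card : ℝ) * ((4 * M) ^ n * 2 ^ (2 * n * L)) :=
            mul_le_mul hsum h5 hDr.le (Nat.cast_nonneg _)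
        _ = (4 * M) ^ n * (2 ^ (2 * n * L) * R.card) := by ring
        _ ≤ (4 * M) ^ n * ((P.card : ℝ) * T) ^ 2 := by
            gcongr
            exact hcard.trans h4
        _ = _ := by ring

open Classical in
lemma exists_card_cell_le (hn : 1 ≤ n) :
    ∃ C : ℝ, 0 < C ∧ ∀ (D : ℕ), 0 < D → ∀ P : Finset (EuclideanSpace ℝ (Fin n)),
      ∃ Q : MvPolynomial (Fin n) ℝ, Q ≠ 0 ∧ Q.totalDegree ≤ D ∧
        ∀ x, ((P.filter (· ∈ cell Q x)).card : ℝ) ≤ C * P.card / (D : ℝ) ^ n := by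
  obtain ⟨A, hA, hmean⟩ := exists_sum_card_cell_le hn
  refine ⟨A * 9 ^ n + 1, by positivity, fun D => ?_⟩
  induction D using Nat.strong_induction_on with
  | _ D ih =>
  intro hD P
  have hP0 : (0 : ℝ) ≤ P.card := Nat.cast_nonneg _
  rcases Nat.lt_or_ge D 2 with hlt | hge
  · obtain rfl : D = 1 := by omega
    refine ⟨1, one_ne_zero, by simp, fun x => ?_⟩
    have h1 : ((P.filter (· ∈ cell 1 x)).card : ℝ) ≤ P.card :=
      Nat.cast_le.mpr (Finset.card_filter_le _ _)
    rw [Nat.cast_one, one_pow, div_one]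
    have : 0 ≤ A * 9 ^ n * P.card := by positivity
    linarith
  set d := D / 2 with hd
  have hd0 : 0 < d := by omega
  have hdr : (0 : ℝ) < (d : ℝ) ^ n := by positivity
  have hDr : (0 : ℝ) < (D : ℝ) ^ n := by positivity
  have hDd : (D : ℝ) ^ n ≤ 3 ^ n * (d : ℝ) ^ n := by
    rw [← mul_pow]
    gcongr
    have : D ≤ 3 * d := by omega
    exact_mod_cast this
  obtain ⟨Q₁, hQ₁, hdeg₁, hsum⟩ := hmean P d hd0
  set t : ℝ := A * 3 ^ n * P.card / (d : ℝ) ^ n with ht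
  set H : Finset (EuclideanSpace ℝ (Fin n)) :=
    P.filter fun x => t < ((P.filter (· ∈ cell Q₁ x)).card : ℝ) with hH
  obtain ⟨Q₂, hQ₂, hdeg₂, hcell₂⟩ := ih d (by omega) hd0 H
  have hHcard : (H.card : ℝ) * 3 ^ n ≤ P.card := by
    have h1 : (H.card : ℝ) * t ≤ A * (P.card : ℝ) ^ 2 / (d : ℝ) ^ n := by
      refine le_trans ?_ hsum
      calc (H.card : ℝ) * t = ∑ _x ∈ H, t := by rw [Finset.sum_const, nsmul_eq_mul]
        _ ≤ ∑ x ∈ H, ((P.filter (· ∈ cell Q₁ x)).card : ℝ) :=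
            Finset.sum_le_sum fun x hx => (Finset.mem_filter.mp hx).2.le
        _ ≤ _ := Finset.sum_le_sum_of_subset_of_nonneg (Finset.filter_subset _ _)
            fun _ _ _ => Nat.cast_nonneg _
    rcases hP0.eq_or_lt with h0 | hpos
    · have h2 : (H.card : ℝ) ≤ P.card := Nat.cast_le.mpr (Finset.card_filter_le _ _)
      rw [← h0] at h2 ⊢
      exact mul_nonpos_of_nonpos_of_nonneg h2 (by positivity)
    · rw [ht, mul_div_assoc', div_le_div_iff_of_pos_right hdr] at h1
      refine le_of_mul_le_mul_left ?_ (mul_pos hA hpos)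
      calc A * P.card * (H.card * 3 ^ n) = H.card * (A * 3 ^ n * P.card) := by ring
        _ ≤ _ := h1
        _ = _ := by ring
  refine ⟨Q₁ * Q₂, mul_ne_zero hQ₁ hQ₂, (totalDegree_mul _ _).trans (by omega), fun x => ?_⟩
  rcases (P.filter (· ∈ cell (Q₁ * Q₂) x)).eq_empty_or_nonempty with hempty | ⟨y, hy⟩
  · rw [hempty, Finset.card_empty, Nat.cast_zero]
    positivity
  obtain ⟨hyP, hyx⟩ := Finset.mem_filter.mp hy
  rw [cell_eq hyx]
  by_cases hyH : t < ((P.filter (· ∈ cell Q₁ y)).card : ℝ)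
  · have hsub : P.filter (· ∈ cell (Q₁ * Q₂) y) ⊆ H.filter (· ∈ cell Q₂ y) := by
      intro z hz
      obtain ⟨hzP, hzy⟩ := Finset.mem_filter.mp hz
      refine Finset.mem_filter.mpr ⟨Finset.mem_filter.mpr ⟨hzP, ?_⟩,
        cell_mul_subset_right _ _ _ hzy⟩
      rw [← cell_eq (cell_mul_subset_left _ _ _ hzy)]
      exact hyH
    have h1 : ((P.filter (· ∈ cell (Q₁ * Q₂) y)).card : ℝ) ≤
        (A * 9 ^ n + 1) * H.card / (d : ℝ) ^ n :=
      (Nat.cast_le.mpr (Finset.card_le_card hsub)).trans (hcell₂ y)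
    refine h1.trans ?_
    rw [div_le_div_iff₀ hdr hDr, mul_assoc, mul_assoc]
    refine mul_le_mul_of_nonneg_left ?_ (by positivity)
    calc (H.card : ℝ) * (D : ℝ) ^ n ≤ H.card * (3 ^ n * (d : ℝ) ^ n) := by gcongr
      _ = H.card * 3 ^ n * (d : ℝ) ^ n := by ring
      _ ≤ P.card * (d : ℝ) ^ n := by gcongr
  · have hsub : P.filter (· ∈ cell (Q₁ * Q₂) y) ⊆ P.filter (· ∈ cell Q₁ y) :=
      Finset.monotone_filter_right P fun z _ hz => cell_mul_subset_left _ _ _ hz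
    have h1 : ((P.filter (· ∈ cell (Q₁ * Q₂) y)).card : ℝ) ≤ t :=
      (Nat.cast_le.mpr (Finset.card_le_card hsub)).trans (not_lt.mp hyH)
    refine h1.trans ?_
    rw [ht, div_le_div_iff₀ hdr hDr]
    calc A * 3 ^ n * P.card * (D : ℝ) ^ n ≤ A * 3 ^ n * P.card * (3 ^ n * (d : ℝ) ^ n) := by gcongr
      _ = A * 9 ^ n * P.card * (d : ℝ) ^ n := by
          rw [show (9 : ℝ) = 3 * 3 by norm_num, mul_pow]; ring
      _ ≤ (A * 9 ^ n + 1) * P.card * (d : ℝ) ^ n := by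
          gcongr
          linarith

end PolynomialCells

/-- Polynomial partition lemma: for every `n ≥ 1` there is `C_n > 0` such that for
every finite point set `P ⊆ ℝ^n` and every `D ≥ 1` there is a nonzero polynomial `Q`
of total degree at most `D` such that every connected component (cell) of the
complement of the zero set of `Q` contains at most `C_n · |P| / D^n` points of `P`. -/
theorem polynomial_partition
    (n : ℕ) (hn : 1 ≤ n) :
    ∃ C : ℝ, 0 < C ∧
      ∀ P : Set (EuclideanSpace ℝ (Fin n)), P.Finite →
        ∀ D : ℕ, 0 < D →
          ∃ Q : MvPolynomial (Fin n) ℝ, Q ≠ 0 ∧ Q.totalDegree ≤ D ∧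
            ∀ x : EuclideanSpace ℝ (Fin n),
              MvPolynomial.eval (fun i => x i) Q ≠ 0 →
              ((P ∩ connectedComponentIn
                  {y : EuclideanSpace ℝ (Fin n) |
                    MvPolynomial.eval (fun i => y i) Q ≠ 0} x).ncard : ℝ)
                ≤ C * (P.ncard : ℝ) / (D : ℝ) ^ n := by
  classical
  obtain ⟨C, hC, h⟩ := exists_card_cell_le hn
  refine ⟨C, hC, fun P hP D hD => ?_⟩
  obtain ⟨Q, hQ, hdeg, hcell⟩ := h D hD hP.toFinset
  refine ⟨Q, hQ, hdeg, fun x _ => ?_⟩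
  have hset : P ∩ cell Q x = ↑(hP.toFinset.filter (· ∈ cell Q x)) := by
    ext y
    simp
  have hx := hcell x
  rw [← Set.ncard_coe_finset, ← hset, ← Set.ncard_eq_toFinset_card P hP] at hx
  exact hx
end
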